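/- arXiv:2605.25754 — 6 statements merged into one kernel-verified Lean document; each statement's English description precedes it below -/
import Mathlib

section
/- Let Γ be a connected amply regular graph with parameters (v, k, λ, μ) whose diameter is at least 3. Then 3(k − λ − 1) ≥ k + 1; equivalently, the number b₁ := k − λ − 1 of neighbors of a vertex y lying at distance 2 from a neighbor x of y satisfies b₁ ≥ (k + 1)/3. -/
/-- An amply regular graph with parameters `(v, k, l, m)`: a `k`-regular graph on `v`
vertices such that adjacent vertices have exactly `l` common neighbours and vertices at
distance two have exactly `m` common neighbours. -/
def IsAmplyRegular {V : Type*} [Fintype V] (G : SimpleGraph V) (v k l m : ℕ) : Prop :=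
  Fintype.card V = v ∧
  (∀ x : V, (G.neighborSet x).ncard = k) ∧
  (∀ x y : V, G.Adj x y → (G.commonNeighbors x y).ncard = l) ∧
  (∀ x y : V, G.dist x y = 2 → (G.commonNeighbors x y).ncard = m)

theorem path_three {V : Type*} [Fintype V] (G : SimpleGraph V)
    (hconn : G.Connected) (hdiam : 3 ≤ G.diam) :
    ∃ x y z w : V, G.Adj x y ∧ G.Adj y z ∧ G.Adj z w ∧ 3 ≤ G.dist x w := by
  have := hconn.nonempty
  obtain ⟨u, v, huv⟩ := G.exists_dist_eq_diam
  obtain ⟨p, hp⟩ := hconn.exists_walk_length_eq_dist u v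
  have h3 : 3 ≤ p.length := by omega
  have e0 := p.adj_getVert_succ (i := 0) (by omega)
  have e1 := p.adj_getVert_succ (i := 1) (by omega)
  have e2 := p.adj_getVert_succ (i := 2) (by omega)
  refine ⟨p.getVert 0, p.getVert 1, p.getVert 2, p.getVert 3, e0, e1, e2, ?_⟩
  rw [p.getVert_zero]
  have t := hconn.dist_triangle (u := u) (v := p.getVert 3) (w := v)
  have d := SimpleGraph.dist_le (p.drop 3)
  rw [SimpleGraph.Walk.drop_length] at d
  omega

/-- Counting around `y` with neighbours `x`, `z` that are distinct and non-adjacent. -/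
theorem count_aux {V : Type*} [Fintype V] (G : SimpleGraph V) (k l : ℕ)
    (hk : ∀ x : V, (G.neighborSet x).ncard = k)
    (hl : ∀ x y : V, G.Adj x y → (G.commonNeighbors x y).ncard = l)
    (x y z : V) (hxy : G.Adj x y) (hyz : G.Adj y z) (hne : x ≠ z) (hn : ¬ G.Adj x z) :
    2 * l + 2 ≤ k + (G.commonNeighbors x y ∩ G.commonNeighbors y z).ncard := by
  have h1 := Set.ncard_union_add_ncard_inter (G.commonNeighbors x y) (G.commonNeighbors y z)
  rw [hl x y hxy, hl y z hyz] at h1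
  have hd : Disjoint (G.commonNeighbors x y ∪ G.commonNeighbors y z) {x, z} := by
    rw [Set.disjoint_left]
    rintro a ha hb
    simp only [Set.mem_insert_iff, Set.mem_singleton_iff] at hb
    simp only [Set.mem_union, SimpleGraph.mem_commonNeighbors] at ha
    rcases hb with rfl | rfl
    · rcases ha with ha | ha
      · exact G.loopless.irrefl _ ha.1
      · exact hn ha.2.symm
    · rcases ha with ha | ha
      · exact hn ha.1
      · exact G.loopless.irrefl _ ha.2
  have h2 := Set.ncard_union_eq hd
  rw [Set.ncard_pair hne] at h2
  have h3 : (G.commonNeighbors x y ∪ G.commonNeighbors y z) ∪ {x, z} ⊆ G.neighborSet y := by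
    rintro a ((ha | ha) | ha)
    · exact ha.2
    · exact ha.1
    · rcases ha with rfl | rfl
      · exact hxy.symm
      · exact hyz
  have h4 := Set.ncard_le_ncard h3
  rw [hk y] at h4
  omega

/-- Let `Γ` be a connected amply regular graph with parameters `(v, k, λ, μ)` whose
diameter is at least `3`. Then `3 * (k - λ - 1) ≥ k + 1`. -/
theorem stmt0 {V : Type*} [Fintype V] (G : SimpleGraph V) (v k l m : ℕ)
    (hG : IsAmplyRegular G v k l m) (hconn : G.Connected) (hdiam : 3 ≤ G.diam) :
    3 * ((k : ℤ) - l - 1) ≥ k + 1 := by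
  obtain ⟨-, hk, hl, -⟩ := hG
  obtain ⟨x, y, z, w, hxy, hyz, hzw, hd⟩ := path_three G hconn hdiam
  have no2 : ∀ a, G.Adj x a → ¬ G.Adj a w := fun a h1 h2 => by
    have := SimpleGraph.dist_le (SimpleGraph.Walk.cons h1 (SimpleGraph.Walk.cons h2 .nil))
    simp at this
    omega
  have no1 : ¬ G.Adj x w := fun h => by
    have := SimpleGraph.dist_le (SimpleGraph.Walk.cons h .nil)
    simp at this
    omega
  have c1 := count_aux G k l hk hl x y z hxy hyz
    (by rintro rfl; exact no1 hzw) (fun h => no2 z h hzw)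
  have c2 := count_aux G k l hk hl y z w hyz hzw
    (by rintro rfl; exact no1 hxy) (fun h => no2 y hxy h)
  have hdj : Disjoint (G.commonNeighbors x y ∩ G.commonNeighbors y z)
      (G.commonNeighbors y z ∩ G.commonNeighbors z w) := by
    rw [Set.disjoint_left]
    rintro a ha hb
    exact no2 a ha.1.1 (SimpleGraph.Adj.symm hb.2.2)
  have h2 := Set.ncard_union_eq hdj
  have h3 := Set.ncard_le_ncard (Set.union_subset (Set.inter_subset_right (s := G.commonNeighbors x y) (t := G.commonNeighbors y z))
    (Set.inter_subset_left (s := G.commonNeighbors y z) (t := G.commonNeighbors z w)))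
  rw [hl y z hyz] at h3
  omega
end

section
/- Let G be a bipartite graph with parts X and Y, where |X| = n ≥ 1 and |Y| = α ≥ 2, and let e denote the number of edges of G. Then there exist two distinct vertices y₁, y₂ ∈ Y whose number m of common neighbors (in X) satisfies m · n · α · (α − 1) ≥ e · (e − n); equivalently, some pair of distinct vertices of Y has at least w²/n − w(n − w)/(n(α − 1)) common neighbors, where w = e/α is the average number of neighbors in X of a vertex of Y. -/
/-- Let `G` be a bipartite graph with parts `X` and `Y`, where `|X| = n ≥ 1` and
`|Y| = α ≥ 2`, and let `e` denote the number of edges of `G`.  Then there exist two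
distinct vertices `y₁, y₂ ∈ Y` whose number `m` of common neighbours satisfies
`m * n * α * (α - 1) ≥ e * (e - n)` (as integers). -/
theorem stmt1 {V : Type*} [Fintype V] (G : SimpleGraph V) (X Y : Set V)
    (hcover : ∀ v : V, v ∈ X ∨ v ∈ Y) (hdisj : Disjoint X Y)
    (hbip : ∀ x y : V, G.Adj x y → (x ∈ X ∧ y ∈ Y) ∨ (x ∈ Y ∧ y ∈ X))
    (n α e : ℕ) (hX : X.ncard = n) (hY : Y.ncard = α)
    (hn : 1 ≤ n) (hα : 2 ≤ α) (he : G.edgeSet.ncard = e) :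
    ∃ y₁ ∈ Y, ∃ y₂ ∈ Y, y₁ ≠ y₂ ∧
      ((G.commonNeighbors y₁ y₂).ncard : ℤ) * n * α * ((α : ℤ) - 1)
        ≥ (e : ℤ) * ((e : ℤ) - (n : ℤ)) := by
  classical
  set S := X.toFinset with hS
  set T := Y.toFinset with hT
  have hSn : S.card = n := by rw [← hX, Set.ncard_eq_toFinset_card']
  have hTn : T.card = α := by rw [← hY, Set.ncard_eq_toFinset_card']
  have hB : G.IsBipartiteWith (S : Set V) (T : Set V) := by
    refine ⟨by simpa [hS, hT] using hdisj, ?_⟩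
    intro x y h
    simpa [hS, hT] using hbip x y h
  let a : V → V → ℤ := fun x y => if G.Adj x y then 1 else 0
  have ha2 : ∀ x y, a x y * a x y = a x y := by
    intro x y
    by_cases h : G.Adj x y <;> simp [a, h]
  have hdeg : ∀ x ∈ S, (G.degree x : ℤ) = ∑ y ∈ T, a x y := by
    intro x hx
    rw [← SimpleGraph.card_neighborFinset_eq_degree,
      SimpleGraph.isBipartiteWith_neighborFinset hB hx, Finset.card_filter]
    push_cast
    rfl
  have hsum : ∑ x ∈ S, ∑ y ∈ T, a x y = (e : ℤ) := by
    have h1 := SimpleGraph.isBipartiteWith_sum_degrees_eq_card_edges hB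
    have h2 : G.edgeFinset.card = e := by
      rw [← he, Set.ncard_eq_toFinset_card']
      rfl
    rw [← h2, ← h1]
    push_cast
    exact (Finset.sum_congr rfl hdeg).symm
  have hc : ∀ y₁ ∈ T, ∀ y₂ : V, ((G.commonNeighbors y₁ y₂).ncard : ℤ)
      = ∑ x ∈ S, a x y₁ * a x y₂ := by
    intro y₁ h1 y₂
    have : (G.commonNeighbors y₁ y₂) =
        ((S.filter fun x => G.Adj x y₁ ∧ G.Adj x y₂ : Finset V) : Set V) := by
      ext x
      simp only [SimpleGraph.mem_commonNeighbors, Finset.coe_filter, Set.mem_ofPred_eq]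
      constructor
      · rintro ⟨h, h'⟩
        refine ⟨?_, h.symm, h'.symm⟩
        have hy : y₁ ∈ Y := by simpa [hT] using h1
        rcases hbip _ _ h with h4 | h4
        · exact absurd hy (Set.disjoint_left.1 hdisj h4.1)
        · simpa [hS] using h4.2
      · rintro ⟨_, h, h'⟩
        exact ⟨h.symm, h'.symm⟩
    rw [this, Set.ncard_coe_finset, Finset.card_filter]
    push_cast
    refine Finset.sum_congr rfl fun x _ => ?_
    by_cases h : G.Adj x y₁ <;> by_cases h' : G.Adj x y₂ <;> simp [a, h, h']
  have hoff : ∑ p ∈ T.offDiag, ((G.commonNeighbors p.1 p.2).ncard : ℤ)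
      = ∑ x ∈ S, (∑ y ∈ T, a x y) ^ 2 - e := by
    rw [← hsum, ← Finset.sum_sub_distrib]
    rw [Finset.sum_congr rfl (fun p hp => hc p.1 (Finset.mem_offDiag.1 hp).1 p.2),
      Finset.sum_comm]
    refine Finset.sum_congr rfl fun x _ => ?_
    have h3 : ∑ p ∈ T ×ˢ T, a x p.1 * a x p.2 = (∑ y ∈ T, a x y) ^ 2 := by
      rw [sq, Finset.sum_mul_sum, Finset.sum_product]
    rw [← h3, ← Finset.diag_union_offDiag, Finset.sum_union (Finset.disjoint_diag_offDiag T),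
      Finset.sum_diag]
    simp only [ha2]
    ring
  have hcs : (e : ℤ) ^ 2 ≤ n * ∑ x ∈ S, (∑ y ∈ T, a x y) ^ 2 := by
    rw [← hsum, ← hSn]
    exact sq_sum_le_card_mul_sum_sq
  have hcard : (T.offDiag.card : ℤ) = α * ((α : ℤ) - 1) := by
    rw [Finset.offDiag_card, hTn, Nat.cast_sub (Nat.le_mul_self α)]
    push_cast
    ring
  have hα' : (2 : ℤ) ≤ α := by exact_mod_cast hα
  have hpos : 0 < (α : ℤ) * ((α : ℤ) - 1) := by
    apply mul_pos <;> linarith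
  have hne : T.offDiag.Nonempty := by
    rw [← Finset.card_pos]
    exact_mod_cast hcard ▸ hpos
  obtain ⟨p, hp, hle⟩ := Finset.exists_le_of_sum_le hne
    (f := fun _ => (e : ℤ) * ((e : ℤ) - (n : ℤ)))
    (g := fun p => ((G.commonNeighbors p.1 p.2).ncard : ℤ) * (n * α * ((α : ℤ) - 1))) (by
      rw [Finset.sum_const, nsmul_eq_mul, hcard, ← Finset.sum_mul, hoff]
      nlinarith [mul_le_mul_of_nonneg_left hcs hpos.le])
  rw [Finset.mem_offDiag] at hp
  refine ⟨p.1, by simpa [hT] using hp.1, p.2, by simpa [hT] using hp.2.1, hp.2.2, ?_⟩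
  linarith
end

section
/- Let Γ be a connected amply regular graph with diameter d ≥ 4 and parameters (v, k, λ, μ), where k ≥ 5 is odd and μ = (k − 1)/2 (equivalently 2μ = k − 1). Then λ = 0 and d ≤ 5. -/
open Classical in
/-- Finset form of the data used throughout the proof. -/
structure ARData {V : Type*} [Fintype V] (G : SimpleGraph V) (l m : ℕ) : Prop where
  conn : G.Connected
  deg : ∀ x : V, (Finset.univ.filter (fun z => G.Adj x z)).card = 2 * m + 1
  adj : ∀ x y : V, G.Adj x y → (Finset.univ.filter (fun z => G.Adj x z ∧ G.Adj y z)).card = l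
  two : ∀ x y : V, G.dist x y = 2 →
    (Finset.univ.filter (fun z => G.Adj x z ∧ G.Adj y z)).card = m
  hm : 2 ≤ m

namespace ARData

variable {V : Type*} [Fintype V] {G : SimpleGraph V} {l m : ℕ}

theorem exists_between (h : ARData G l m) (x y : V) (i : ℕ) (hi : i ≤ G.dist x y) :
    ∃ z, G.dist x z = i ∧ G.dist z y = G.dist x y - i := by
  obtain ⟨p, hp⟩ := h.conn.exists_walk_length_eq_dist x y
  refine ⟨p.getVert i, ?_⟩
  have h1 := SimpleGraph.dist_le (p.take i)
  have h2 := SimpleGraph.dist_le (p.drop i)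
  have h3 := h.conn.dist_triangle (u := x) (v := p.getVert i) (w := y)
  rw [SimpleGraph.Walk.take_length] at h1
  rw [SimpleGraph.Walk.drop_length] at h2
  omega

theorem adj_iff (x y : V) : G.Adj x y ↔ G.dist x y = 1 := SimpleGraph.dist_eq_one_iff_adj.symm

theorem dist_two (h : ARData G l m) {x y z : V} (hne : x ≠ y) (hna : ¬ G.Adj x y)
    (h1 : G.Adj x z) (h2 : G.Adj z y) : G.dist x y = 2 := by
  have h3 := h.conn.dist_triangle (u := x) (v := z) (w := y)
  rw [adj_iff] at h1 h2 hna
  have := h.conn.pos_dist_of_ne hne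
  omega

open Classical in
/-- In the middle of a geodesic of length four, one neighbour is left over. -/
theorem rest (h : ARData G l m) {x y z : V} (hxy : G.dist x y = 4) (hxz : G.dist x z = 2)
    (hzy : G.dist z y = 2) :
    (Finset.univ.filter (fun w => G.Adj z w ∧ ¬ G.Adj x w ∧ ¬ G.Adj y w)).card ≤ 1 := by
  have hA := h.two x z hxz
  have hB := h.two z y hzy
  have hd := h.deg z
  have hAB : Disjoint (Finset.univ.filter (fun w => G.Adj x w ∧ G.Adj z w))
      (Finset.univ.filter (fun w => G.Adj z w ∧ G.Adj y w)) := by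
    rw [Finset.disjoint_left]
    intro w h1 h2
    simp only [Finset.mem_filter, Finset.mem_univ, true_and] at h1 h2
    have h3 := h.conn.dist_triangle (u := x) (v := w) (w := y)
    have h4 := h1.1
    have h5 := h2.2.symm
    rw [adj_iff] at h4 h5
    omega
  have hABC : Disjoint ((Finset.univ.filter (fun w => G.Adj x w ∧ G.Adj z w)) ∪
      (Finset.univ.filter (fun w => G.Adj z w ∧ G.Adj y w)))
      (Finset.univ.filter (fun w => G.Adj z w ∧ ¬ G.Adj x w ∧ ¬ G.Adj y w)) := by
    rw [Finset.disjoint_left]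
    intro w h1 h2
    simp only [Finset.mem_filter, Finset.mem_univ, true_and, Finset.mem_union] at h1 h2
    tauto
  have hsub : ((Finset.univ.filter (fun w => G.Adj x w ∧ G.Adj z w)) ∪
      (Finset.univ.filter (fun w => G.Adj z w ∧ G.Adj y w))) ∪
      (Finset.univ.filter (fun w => G.Adj z w ∧ ¬ G.Adj x w ∧ ¬ G.Adj y w)) ⊆
      Finset.univ.filter (fun w => G.Adj z w) := by
    intro w h1
    simp only [Finset.mem_filter, Finset.mem_univ, true_and, Finset.mem_union] at h1 ⊢
    tauto
  have := Finset.card_le_card hsub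
  rw [Finset.card_union_of_disjoint hABC, Finset.card_union_of_disjoint hAB] at this
  omega

open Classical in
/-- Common neighbours of `a` and `z` are, up to one, adjacent to `x`. -/
theorem common (h : ARData G l m) {x y z a : V} (hxy : G.dist x y = 4)
    (hzy : G.dist z y = 2) (hxa : G.Adj x a) (haz : G.Adj a z) :
    l ≤ (Finset.univ.filter (fun w => (G.Adj a w ∧ G.Adj x w) ∧ G.Adj z w)).card + 1 := by
  have hxz : G.dist x z = 2 := by
    have h1 := h.conn.dist_triangle (u := x) (v := a) (w := z)
    have h2 := h.conn.dist_triangle (u := x) (v := z) (w := y)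
    rw [adj_iff] at hxa haz
    omega
  have hr := h.rest hxy hxz hzy
  have hl := h.adj a z haz
  have hsub : Finset.univ.filter (fun w => G.Adj a w ∧ G.Adj z w) ⊆
      (Finset.univ.filter (fun w => (G.Adj a w ∧ G.Adj x w) ∧ G.Adj z w)) ∪
      (Finset.univ.filter (fun w => G.Adj z w ∧ ¬ G.Adj x w ∧ ¬ G.Adj y w)) := by
    intro w h1
    simp only [Finset.mem_filter, Finset.mem_univ, true_and, Finset.mem_union] at h1 ⊢
    have : ¬ G.Adj y w := by
      intro h5
      have h3 := h.conn.dist_triangle (u := x) (v := a) (w := y)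
      have h4 := h.conn.dist_triangle (u := a) (v := w) (w := y)
      have h6 := h1.1
      have h5 := h5.symm
      rw [adj_iff] at h5 h6 hxa
      omega
    tauto
  have h1 := Finset.card_le_card hsub
  have h2 := Finset.card_union_le (Finset.univ.filter
    (fun w => (G.Adj a w ∧ G.Adj x w) ∧ G.Adj z w))
      (Finset.univ.filter (fun w => G.Adj z w ∧ ¬ G.Adj x w ∧ ¬ G.Adj y w))
  omega

/-- A geodesic of length four, with its second and third vertices. -/
theorem exists_path (h : ARData G l m) {x y : V} (hxy : G.dist x y = 4) :
    ∃ a z, G.Adj x a ∧ G.Adj a z ∧ G.dist a y = 3 ∧ G.dist z y = 2 ∧ G.dist x z = 2 := by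
  obtain ⟨z, hz1, hz2⟩ := h.exists_between x y 2 (by omega)
  obtain ⟨a, ha1, ha2⟩ := h.exists_between x z 1 (by omega)
  refine ⟨a, z, (adj_iff _ _).2 ha1, (adj_iff _ _).2 (by omega), ?_, by omega, hz1⟩
  have h1 := h.conn.dist_triangle (u := x) (v := a) (w := y)
  have h2 := h.conn.dist_triangle (u := a) (v := z) (w := y)
  omega

open Classical in
theorem l_le (h : ARData G l m) {x y : V} (hxy : G.dist x y = 4) : l ≤ m := by
  obtain ⟨a, z, hxa, haz, hay, hzy, hxz⟩ := h.exists_path hxy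
  have h1 := h.common hxy hzy hxa haz
  have h2 := h.two x z hxz
  have h3 : (Finset.univ.filter (fun w => (G.Adj a w ∧ G.Adj x w) ∧ G.Adj z w)).card <
      (Finset.univ.filter (fun w => G.Adj x w ∧ G.Adj z w)).card := by
    apply Finset.card_lt_card
    rw [Finset.ssubset_iff_of_subset]
    · exact ⟨a, by simp [hxa, haz.symm], by simp⟩
    · intro w hw
      simp only [Finset.mem_filter, Finset.mem_univ, true_and] at hw ⊢
      tauto
  omega

open Classical in
theorem c_three (h : ARData G l m) (hl : l ≤ m) {a y : V} (hay : G.dist a y = 3) :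
    m + 1 ≤ (Finset.univ.filter (fun z => G.Adj a z ∧ G.dist z y = 2)).card := by
  by_contra hcon
  set C := Finset.univ.filter (fun z => G.Adj a z ∧ G.dist z y = 2) with hC
  have hm := h.hm
  have key : ∀ u, G.Adj y u → G.dist a u = 2 → ∀ z ∈ C, G.Adj u z := by
    intro u hyu hau
    have h1 := h.two a u hau
    have hsub : Finset.univ.filter (fun w => G.Adj a w ∧ G.Adj u w) ⊆ C := by
      intro w hw
      simp only [hC, Finset.mem_filter, Finset.mem_univ, true_and] at hw ⊢
      refine ⟨hw.1, ?_⟩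
      have h2 := h.conn.dist_triangle (u := a) (v := w) (w := y)
      have h3 := h.conn.dist_triangle (u := w) (v := u) (w := y)
      have h4 := hw.1
      have h5 := hw.2.symm
      have h6 := hyu.symm
      rw [adj_iff] at h4 h5 h6
      omega
    have heq := Finset.eq_of_subset_of_card_le hsub (by omega)
    intro z hz
    rw [← heq] at hz
    simp only [Finset.mem_filter, Finset.mem_univ, true_and] at hz
    exact hz.2
  have hmid : ∀ z ∈ C, ∀ u, G.Adj z u → G.Adj y u → G.dist a u = 2 := by
    intro z hz u hzu hyu
    simp only [hC, Finset.mem_filter, Finset.mem_univ, true_and] at hz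
    have h2 := h.conn.dist_triangle (u := a) (v := u) (w := y)
    have h3 := h.conn.dist_triangle (u := a) (v := z) (w := u)
    have h4 := hz.1
    have h6 := hyu.symm
    rw [adj_iff] at h4 hzu h6
    omega
  obtain ⟨z, hz1, hz2⟩ := h.exists_between a y 1 (by omega)
  have hzC : z ∈ C := by
    simp only [hC, Finset.mem_filter, Finset.mem_univ, true_and]
    exact ⟨(adj_iff _ _).2 hz1, by omega⟩
  have hzy : G.dist z y = 2 := by omega
  have hD := h.two z y hzy
  obtain ⟨u, hu⟩ : (Finset.univ.filter (fun w => G.Adj z w ∧ G.Adj y w)).Nonempty := by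
    rw [← Finset.card_pos]; omega
  simp only [Finset.mem_filter, Finset.mem_univ, true_and] at hu
  have hau := hmid z hzC u hu.1 hu.2
  have hCm : 1 < C.card := by
    have h1 := h.two a u hau
    have hsub : Finset.univ.filter (fun w => G.Adj a w ∧ G.Adj u w) ⊆ C := by
      intro w hw
      simp only [hC, Finset.mem_filter, Finset.mem_univ, true_and] at hw ⊢
      refine ⟨hw.1, ?_⟩
      have h2 := h.conn.dist_triangle (u := a) (v := w) (w := y)
      have h3 := h.conn.dist_triangle (u := w) (v := u) (w := y)
      have h4 := hw.1
      have h5 := hw.2.symm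
      have h6 := hu.2.symm
      rw [adj_iff] at h4 h5 h6
      omega
    have := Finset.card_le_card hsub
    omega
  obtain ⟨z', hz', hne⟩ := Finset.exists_mem_ne hCm z
  have hlt : (Finset.univ.filter (fun w => G.Adj z w ∧ G.Adj y w)).card <
      (Finset.univ.filter (fun w => G.Adj z w ∧ G.Adj z' w)).card := by
    have hz'a : G.Adj a z' := by
      simp only [hC, Finset.mem_filter, Finset.mem_univ, true_and] at hz'
      exact hz'.1
    have hza : G.Adj a z := (adj_iff _ _).2 hz1
    apply Finset.card_lt_card
    rw [Finset.ssubset_iff_of_subset]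
    · refine ⟨a, by simp [hza.symm, hz'a.symm], ?_⟩
      simp only [Finset.mem_filter, Finset.mem_univ, true_and]
      rintro ⟨-, h2⟩
      have h2 := h2.symm
      rw [adj_iff] at h2
      omega
    · intro w hw
      simp only [Finset.mem_filter, Finset.mem_univ, true_and] at hw ⊢
      exact ⟨hw.1, (key w hw.2 (hmid z hzC w hw.1 hw.2) z' hz').symm⟩
  by_cases hadj : G.Adj z z'
  · have := h.adj z z' hadj
    omega
  · have hz'a : G.Adj a z' := by
      simp only [hC, Finset.mem_filter, Finset.mem_univ, true_and] at hz'
      exact hz'.1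
    have hza : G.Adj a z := (adj_iff _ _).2 hz1
    have := h.two z z' (h.dist_two hne.symm hadj hza.symm hz'a)
    omega

open Classical in
theorem l_le_one (h : ARData G l m) {x y : V} (hxy : G.dist x y = 4) : l ≤ 1 := by
  have hlm := h.l_le hxy
  obtain ⟨a, z, hxa, haz, hay, hzy, hxz⟩ := h.exists_path hxy
  have hc := h.c_three hlm hay
  set C := Finset.univ.filter (fun z => G.Adj a z ∧ G.dist z y = 2) with hC
  set U := Finset.univ.filter (fun w => G.Adj a w ∧ G.Adj x w) with hU
  have hUc : U.card = l := h.adj a x hxa.symm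
  have hmul := Finset.card_mul_le_card_mul (s := C) (t := U) G.Adj (m := l - 1) (n := l - 1)
    (by
      intro z hz
      simp only [hC, Finset.mem_filter, Finset.mem_univ, true_and] at hz
      have h1 := h.common hxy hz.2 hxa hz.1
      have h2 : Finset.univ.filter (fun w => (G.Adj a w ∧ G.Adj x w) ∧ G.Adj z w) =
          U.bipartiteAbove G.Adj z := by
        ext w
        simp [Finset.bipartiteAbove, hU]
      rw [h2] at h1
      omega)
    (by
      intro u hu
      simp only [hU, Finset.mem_filter, Finset.mem_univ, true_and] at hu
      have h1 := h.adj a u hu.1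
      have h3 : (C.bipartiteBelow G.Adj u).card <
          (Finset.univ.filter (fun w => G.Adj a w ∧ G.Adj u w)).card := by
        apply Finset.card_lt_card
        rw [Finset.ssubset_iff_of_subset]
        · refine ⟨x, by simp [hxa.symm, hu.2.symm], ?_⟩
          simp [Finset.bipartiteBelow, hC, hxy]
        · intro w hw
          simp only [Finset.bipartiteBelow, hC, Finset.mem_filter, Finset.mem_univ,
            true_and] at hw ⊢
          exact ⟨hw.1.1, hw.2.symm⟩
      omega)
  rw [hUc] at hmul
  by_contra hcon
  have h2 : C.card ≤ l := Nat.le_of_mul_le_mul_right hmul (by omega)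
  omega

open Classical in
theorem l_ne_one (h : ARData G l m) (x : V) : l ≠ 1 := by
  intro hl
  have hreg : ∀ v : G.neighborSet x, (G.induce (G.neighborSet x)).degree v = 1 := by
    intro v
    rw [← hl, ← h.adj x v.1 v.2, ← SimpleGraph.card_neighborFinset_eq_degree]
    refine Finset.card_bij (fun w _ => w.1) ?_ ?_ ?_
    · intro w hw
      simp only [SimpleGraph.mem_neighborFinset, SimpleGraph.comap_adj,
        Function.Embedding.subtype_apply] at hw
      simp only [Finset.mem_filter, Finset.mem_univ, true_and]
      exact ⟨w.2, hw⟩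
    · intro w _ w' _ hh
      exact Subtype.ext hh
    · intro w hw
      simp only [Finset.mem_filter, Finset.mem_univ, true_and] at hw
      refine ⟨⟨w, hw.1⟩, ?_, rfl⟩
      simp only [SimpleGraph.mem_neighborFinset, SimpleGraph.comap_adj,
        Function.Embedding.subtype_apply]
      exact hw.2
  have hs := (G.induce (G.neighborSet x)).sum_degrees_eq_twice_card_edges
  simp only [hreg, Finset.sum_const, Finset.card_univ, smul_eq_mul, mul_one] at hs
  have hd := h.deg x
  rw [Fintype.card_subtype] at hs
  simp only [SimpleGraph.mem_neighborSet] at hs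
  omega

open Classical in
theorem no_six (h : ARData G l m) (hl : l ≤ m) {x y : V} (hxy : G.dist x y = 6) : False := by
  obtain ⟨a, h1, h2⟩ := h.exists_between x y 3 (by omega)
  have hA := h.c_three hl (a := a) (y := x) (by rw [SimpleGraph.dist_comm]; exact h1)
  have hB := h.c_three hl (a := a) (y := y) (by omega)
  have hd := h.deg a
  have hAB : Disjoint (Finset.univ.filter (fun z => G.Adj a z ∧ G.dist z x = 2))
      (Finset.univ.filter (fun z => G.Adj a z ∧ G.dist z y = 2)) := by
    rw [Finset.disjoint_left]
    intro w h3 h4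
    simp only [Finset.mem_filter, Finset.mem_univ, true_and] at h3 h4
    have h5 := h.conn.dist_triangle (u := x) (v := w) (w := y)
    have h6 := h3.2
    rw [SimpleGraph.dist_comm] at h6
    omega
  have hsub : (Finset.univ.filter (fun z => G.Adj a z ∧ G.dist z x = 2)) ∪
      (Finset.univ.filter (fun z => G.Adj a z ∧ G.dist z y = 2)) ⊆
      Finset.univ.filter (fun w => G.Adj a w) := by
    intro w hw
    simp only [Finset.mem_filter, Finset.mem_univ, true_and, Finset.mem_union] at hw ⊢
    tauto
  have := Finset.card_le_card hsub
  rw [Finset.card_union_of_disjoint hAB] at this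
  omega

end ARData

open Classical in
theorem arData_of {V : Type*} [Fintype V] (G : SimpleGraph V) (v k l μ : ℕ)
    (hG : IsAmplyRegular G v k l μ) (hconn : G.Connected)
    (hk5 : 5 ≤ k) (hμ : 2 * μ = k - 1) : ARData G l μ := by
  obtain ⟨-, h1, h2, h3⟩ := hG
  refine ⟨hconn, ?_, ?_, ?_, by omega⟩
  · intro x
    have := h1 x
    rw [Set.ncard_eq_toFinset_card'] at this
    rw [show 2 * μ + 1 = k by omega, ← this]
    congr 1
    ext w
    simp
  · intro x y hxy
    have := h2 x y hxy
    rw [Set.ncard_eq_toFinset_card'] at this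
    rw [← this]
    congr 1
    ext w
    simp [SimpleGraph.mem_commonNeighbors]
  · intro x y hxy
    have := h3 x y hxy
    rw [Set.ncard_eq_toFinset_card'] at this
    rw [← this]
    congr 1
    ext w
    simp [SimpleGraph.mem_commonNeighbors]

/-- Let `Γ` be a connected amply regular graph with diameter `d ≥ 4` and parameters
`(v, k, λ, μ)`, where `k ≥ 5` is odd and `2μ = k - 1`.  Then `λ = 0` and `d ≤ 5`. -/
theorem stmt4 {V : Type*} [Fintype V] (G : SimpleGraph V) (v k l μ : ℕ)
    (hG : IsAmplyRegular G v k l μ) (hconn : G.Connected)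
    (hk5 : 5 ≤ k) (hkodd : Odd k) (hμ : 2 * μ = k - 1)
    (hdiam : 4 ≤ G.diam) :
    l = 0 ∧ G.diam ≤ 5 := by
  have h := arData_of G v k l μ hG hconn hk5 hμ
  have : Nonempty V := hconn.nonempty
  obtain ⟨x, y, hxy⟩ := G.exists_dist_eq_diam
  obtain ⟨y4, h4, -⟩ := h.exists_between x y 4 (by omega)
  refine ⟨?_, ?_⟩
  · have h1 := h.l_le_one h4
    have h2 := h.l_ne_one x
    omega
  · by_contra hcon
    obtain ⟨y6, h6, -⟩ := h.exists_between x y 6 (by omega)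
    exact h.no_six (h.l_le h4) h6
end

section
/- Let Γ be a connected bipartite amply regular graph with diameter 5 and parameters (v, k, 0, (k − 1)/2), where k ≥ 5 is odd. Then v = 6k + 2 and Γ is distance-regular with intersection array (k, k − 1, (k+1)/2, (k−1)/2, 1; 1, (k−1)/2, (k+1)/2, k − 1, k); that is, for every pair of vertices x, y at distance i (1 ≤ i ≤ 5), the number of neighbors of y at distance i − 1 from x equals c_i and the number of neighbors of y at distance i + 1 from x equals b_i, where (c₁, c₂, c₃, c₄, c₅) = (1, (k−1)/2, (k+1)/2, k − 1, k) and (b₀, b₁, b₂, b₃, b₄) = (k, k − 1, (k+1)/2, (k−1)/2, 1). -/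
/-- A graph is bipartite if its vertex set can be partitioned into two parts so that
every edge joins vertices in different parts. -/
def IsBipartiteGraph {V : Type*} (G : SimpleGraph V) : Prop :=
  ∃ X : Set V, ∀ ⦃x y : V⦄, G.Adj x y → (x ∈ X ↔ y ∉ X)

/-- The sequence `(c₁, c₂, c₃, c₄, c₅) = (1, (k-1)/2, (k+1)/2, k-1, k)`, where
`μ = (k-1)/2` (so `μ + 1 = (k+1)/2` for odd `k`). -/
def cArr (k μ : ℕ) : ℕ → ℕ
  | 1 => 1
  | 2 => μ
  | 3 => μ + 1
  | 4 => k - 1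
  | 5 => k
  | _ => 0

/-- The sequence `(b₀, b₁, b₂, b₃, b₄) = (k, k-1, (k+1)/2, (k-1)/2, 1)`, where
`μ = (k-1)/2`. -/
def bArr (k μ : ℕ) : ℕ → ℕ
  | 0 => k
  | 1 => k - 1
  | 2 => μ + 1
  | 3 => μ
  | 4 => 1
  | _ => 0


open Classical in
/-- The working facts about the graph. -/
structure GoodGraph {V : Type*} [Fintype V] (G : SimpleGraph V) (m : ℕ) : Prop where
  conn : G.Connected
  two : 2 ≤ m
  step : ∀ x u w : V, G.Adj u w → G.dist x w = G.dist x u + 1 ∨ G.dist x u = G.dist x w + 1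
  deg : ∀ x : V, (Finset.univ.filter (fun z => G.Adj x z)).card = 2 * m + 1
  com : ∀ x y : V, G.dist x y = 2 →
    (Finset.univ.filter (fun z => G.Adj x z ∧ G.Adj y z)).card = m

namespace GoodGraph

open Classical Finset

variable {V : Type*} [Fintype V] {G : SimpleGraph V} {m : ℕ}

theorem pred (h : GoodGraph G m) {x y : V} {i : ℕ} (hd : G.dist x y = i + 1) :
    ∃ z, G.Adj y z ∧ G.dist x z = i := by
  obtain ⟨p, hp⟩ := h.conn.exists_walk_length_eq_dist y x
  rw [SimpleGraph.dist_comm, hd] at hp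
  cases p with
  | nil => simp at hp
  | cons hadj q =>
    rename_i z
    refine ⟨z, hadj, ?_⟩
    have h1 : G.dist z x ≤ q.length := SimpleGraph.dist_le q
    simp only [SimpleGraph.Walk.length_cons] at hp
    rw [SimpleGraph.dist_comm] at h1
    rcases h.step x y z hadj with h2 | h2 <;> omega

theorem d0 (h : GoodGraph G m) {x y : V} : G.dist x y = 0 ↔ x = y := h.conn.dist_eq_zero_iff

theorem d1 {x y : V} : G.dist x y = 1 ↔ G.Adj x y := SimpleGraph.dist_eq_one_iff_adj

theorem d2 (h : GoodGraph G m) {x y z : V} (hne : x ≠ y) (h1 : G.Adj x z) (h2 : G.Adj y z) :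
    G.dist x y = 2 := by
  have h3 := d1.2 h1
  have h4 : G.dist x y ≠ 0 := fun h5 => hne (h.d0.1 h5)
  rcases h.step x z y h2.symm with h5 | h5 <;> omega

theorem split (h : GoodGraph G m) {x y : V} (i : ℕ) (hd : G.dist x y = i + 1) :
    (univ.filter (fun z => G.Adj y z ∧ G.dist x z = i)).card +
    (univ.filter (fun z => G.Adj y z ∧ G.dist x z = i + 2)).card = 2 * m + 1 := by
  rw [← h.deg y, ← card_union_of_disjoint]
  · congr 1
    ext z
    simp only [mem_union, mem_filter, mem_univ, true_and]
    constructor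
    · rintro (h1 | h1) <;> exact h1.1
    · intro h1
      rcases h.step x y z h1 with h2 | h2
      · right; exact ⟨h1, by omega⟩
      · left; exact ⟨h1, by omega⟩
  · rw [disjoint_left]
    intro z h1 h2
    simp only [mem_filter] at h1 h2
    omega

theorem c1 (h : GoodGraph G m) {x y : V} (hd : G.dist x y = 1) :
    (univ.filter (fun z => G.Adj y z ∧ G.dist x z = 0)).card = 1 := by
  rw [card_eq_one]
  refine ⟨x, ?_⟩
  ext z
  simp only [mem_filter, mem_univ, true_and, mem_singleton, h.d0]
  constructor
  · rintro ⟨_, h2⟩; exact h2.symm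
  · rintro rfl; exact ⟨(d1.1 hd).symm, rfl⟩

theorem c2 (h : GoodGraph G m) {x y : V} (hd : G.dist x y = 2) :
    (univ.filter (fun z => G.Adj y z ∧ G.dist x z = 1)).card = m := by
  rw [← h.com x y hd]
  congr 1
  ext z
  simp only [mem_filter, mem_univ, true_and, d1, and_comm]

theorem b2 (h : GoodGraph G m) {x y : V} (hd : G.dist x y = 2) :
    (univ.filter (fun z => G.Adj y z ∧ G.dist x z = 3)).card = m + 1 := by
  have h1 := h.split 1 hd
  have h2 := h.c2 hd
  simp only [Nat.reduceAdd] at h1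
  omega

theorem b1 (h : GoodGraph G m) {x y : V} (hd : G.dist x y = 1) :
    (univ.filter (fun z => G.Adj y z ∧ G.dist x z = 2)).card = 2 * m := by
  have h1 := h.split 0 hd
  have h2 := h.c1 hd
  simp only [Nat.reduceAdd] at h1
  omega

theorem s1 (h : GoodGraph G m) (x : V) :
    (univ.filter (fun z => G.dist x z = 1)).card = 2 * m + 1 := by
  rw [← h.deg x]
  simp only [d1]

theorem s2 (h : GoodGraph G m) (x : V) :
    (univ.filter (fun z => G.dist x z = 2)).card = 2 * (2 * m + 1) := by
  have key := card_mul_eq_card_mul (s := univ.filter (fun z => G.dist x z = 1))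
    (t := univ.filter (fun z => G.dist x z = 2)) (m := 2 * m) (n := m) G.Adj
    (by
      intro a ha
      simp only [mem_filter, mem_univ, true_and] at ha
      rw [← h.b1 ha, bipartiteAbove, filter_filter]
      simp only [and_comm])
    (by
      intro a ha
      simp only [mem_filter, mem_univ, true_and] at ha
      rw [← h.c2 ha, bipartiteBelow, filter_filter]
      simp only [and_comm, SimpleGraph.adj_comm])
  rw [h.s1] at key
  have := h.two
  apply Nat.eq_of_mul_eq_mul_right (show 0 < m by omega)
  rw [← key]; ring

theorem c3 (h : GoodGraph G m) {x z : V} (hd : G.dist x z = 3) :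
    m + 1 ≤ (univ.filter (fun w => G.Adj z w ∧ G.dist x w = 2)).card := by
  by_contra hlt
  have hm := h.two
  have sub : ∀ a, G.Adj x a → G.dist a z = 2 → ∀ w, G.Adj z w → G.dist x w = 2 → G.Adj a w := by
    intro a ha haz w hw hxw
    have hs : univ.filter (fun w => G.Adj a w ∧ G.Adj z w) ⊆
        univ.filter (fun w => G.Adj z w ∧ G.dist x w = 2) := by
      intro t ht
      simp only [mem_filter, mem_univ, true_and] at ht ⊢
      refine ⟨ht.2, ?_⟩
      have h1 := d1.2 ha
      rcases h.step x a t ht.1 with h2 | h2 <;> rcases h.step x z t ht.2 with h3 | h3 <;> omega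
    have he := eq_of_subset_of_card_le hs (by rw [h.com a z haz]; omega)
    have : w ∈ univ.filter (fun w => G.Adj z w ∧ G.dist x w = 2) := by simp [hw, hxw]
    rw [← he] at this
    simp only [mem_filter] at this
    exact this.2.1
  obtain ⟨c, hzc, hxc⟩ := h.pred hd
  have hcc := h.com x c hxc
  obtain ⟨a, ha, a', ha', hne⟩ := one_lt_card.1 (show 1 < (univ.filter
    (fun z => G.Adj x z ∧ G.Adj c z)).card by omega)
  simp only [mem_filter, mem_univ, true_and] at ha ha'
  have haz : ∀ a, G.Adj x a → G.Adj c a → G.dist a z = 2 := by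
    intro a h1 h2
    apply h.d2 _ h2.symm hzc
    rintro rfl
    have := d1.2 h1
    omega
  have h1 := sub a ha.1 (haz a ha.1 ha.2)
  have h2 := sub a' ha'.1 (haz a' ha'.1 ha'.2)
  have haa := h.com a a' (h.d2 hne ha.1.symm ha'.1.symm)
  have hs : insert x (univ.filter (fun w => G.Adj a w ∧ G.Adj z w)) ⊆
      univ.filter (fun z => G.Adj a z ∧ G.Adj a' z) := by
    intro t ht
    simp only [mem_insert, mem_filter, mem_univ, true_and] at ht ⊢
    rcases ht with rfl | ht
    · exact ⟨ha.1.symm, ha'.1.symm⟩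
    · refine ⟨ht.1, h2 t ht.2 ?_⟩
      have h1 := d1.2 ha.1
      rcases h.step x a t ht.1 with h2 | h2 <;> rcases h.step x z t ht.2 with h3 | h3 <;> omega
  have h3 := card_le_card hs
  rw [card_insert_of_notMem, haa, h.com a z (haz a ha.1 ha.2)] at h3
  · omega
  · simp only [mem_filter, mem_univ, true_and, not_and]
    intro _ h5
    have := d1.2 h5.symm
    omega

theorem c4 (h : GoodGraph G m) {x w : V} (hd : G.dist x w = 4) :
    m ≤ (univ.filter (fun z => G.Adj w z ∧ G.dist x z = 3)).card := by
  obtain ⟨c, hwc, hxc⟩ := h.pred hd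
  obtain ⟨b, hcb, hxb⟩ := h.pred hxc
  have hbw : G.dist b w = 2 := by
    apply h.d2 _ hcb.symm hwc
    rintro rfl
    omega
  rw [← h.com b w hbw]
  apply card_le_card
  intro t ht
  simp only [mem_filter, mem_univ, true_and] at ht ⊢
  refine ⟨ht.2, ?_⟩
  rcases h.step x b t ht.1 with h2 | h2 <;> rcases h.step x w t ht.2 with h3 | h3 <;> omega

theorem tri (h : GoodGraph G m) {x y : V} (hd : G.dist x y = 5) (z : V) :
    5 ≤ G.dist x z + G.dist y z := by
  have := h.conn.dist_triangle (u := x) (v := z) (w := y)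
  rw [SimpleGraph.dist_comm (u := z)] at this
  omega

theorem m1 (h : GoodGraph G m) {x y b z : V} (hd : G.dist x y = 5) (hxb : G.dist x b = 2)
    (hyb : G.dist y b = 3) (hbz : G.Adj b z) (hxz : G.dist x z = 3) : G.dist y z = 2 := by
  have hs : univ.filter (fun w => G.Adj b w ∧ G.dist y w = 2) ⊆
      univ.filter (fun w => G.Adj b w ∧ G.dist x w = 3) := by
    intro t ht
    simp only [mem_filter, mem_univ, true_and] at ht ⊢
    refine ⟨ht.1, ?_⟩
    have := h.tri hd t
    rcases h.step x b t ht.1 with h2 | h2 <;> omega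
  have he := eq_of_subset_of_card_le hs (by rw [h.b2 hxb]; exact h.c3 hyb)
  have : z ∈ univ.filter (fun w => G.Adj b w ∧ G.dist x w = 3) := by simp [hbz, hxz]
  rw [← he] at this
  simp only [mem_filter] at this
  exact this.2.2

theorem m2 (h : GoodGraph G m) {x y b : V} (hd : G.dist x y = 5) (hxb : G.dist x b = 2)
    (hle : ∀ u w, G.dist u w ≤ 5) : G.dist y b = 3 := by
  by_contra hyb
  have hm := h.two
  have hyx : G.dist y x = 5 := by rw [SimpleGraph.dist_comm]; exact hd
  have hstep1 : ∀ u, G.Adj x u → G.dist y u = 4 := by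
    intro u hu
    have := hle y u
    rcases h.step y x u hu with h2 | h2 <;> omega
  have hcc := h.com x b hxb
  obtain ⟨u, hu, u2, hu2, hne⟩ := one_lt_card.1 (show 1 < (univ.filter
    (fun z => G.Adj x z ∧ G.Adj b z)).card by omega)
  simp only [mem_filter, mem_univ, true_and] at hu hu2
  have hyu := hstep1 u hu.1
  have hyb5 : G.dist y b = 5 := by
    rcases h.step y u b hu.2.symm with h2 | h2 <;> omega
  have hP : ∀ b', G.Adj u b' → G.dist y b' = 3 → G.Adj u2 b' := by
    intro b' hub hyb'
    have hxb' : G.dist x b' = 2 := by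
      apply h.d2 _ hu.1 hub.symm
      rintro rfl
      omega
    have hbb : G.dist b b' = 2 := by
      apply h.d2 _ hu.2 hub.symm
      rintro rfl
      omega
    have hs : univ.filter (fun w => G.Adj b w ∧ G.Adj b' w) ⊆
        univ.filter (fun z => G.Adj x z ∧ G.Adj b z) := by
      intro t ht
      simp only [mem_filter, mem_univ, true_and] at ht ⊢
      refine ⟨?_, ht.1⟩
      rcases h.step x b t ht.1 with h2 | h2
      · have := h.m1 hd hxb' hyb' ht.2 (by omega)
        rcases h.step y b t ht.1 with h2 | h2 <;> omega
      · exact d1.1 (by omega)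
    have he := eq_of_subset_of_card_le hs (by rw [hcc, h.com b b' hbb])
    have : u2 ∈ univ.filter (fun z => G.Adj x z ∧ G.Adj b z) := by simp [hu2]
    rw [← he] at this
    simp only [mem_filter] at this
    exact this.2.2.symm
  have hs : insert x (univ.filter (fun z => G.Adj u z ∧ G.dist y z = 3)) ⊆
      univ.filter (fun z => G.Adj u z ∧ G.Adj u2 z) := by
    intro t ht
    simp only [mem_insert, mem_filter, mem_univ, true_and] at ht ⊢
    rcases ht with rfl | ht
    · exact ⟨hu.1.symm, hu2.1.symm⟩
    · exact ⟨ht.1, hP t ht.1 ht.2⟩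
  have h3 := card_le_card hs
  rw [card_insert_of_notMem, h.com u u2 (h.d2 hne hu.1.symm hu2.1.symm)] at h3
  · have := h.c4 hyu
    omega
  · simp only [mem_filter, mem_univ, true_and, not_and]
    omega

theorem anti (h : GoodGraph G m) {x y : V} (hd : G.dist x y = 5)
    (hle : ∀ u w, G.dist u w ≤ 5) (w : V) : G.dist x w + G.dist y w = 5 := by
  have hyx : G.dist y x = 5 := by rw [SimpleGraph.dist_comm]; exact hd
  have f1 : ∀ w, G.dist x w = 1 → G.dist y w = 4 := by
    intro w hw
    have := hle y w
    rcases h.step y x w (d1.1 hw) with h2 | h2 <;> omega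
  have f2 : ∀ w, G.dist x w = 2 → G.dist y w = 3 := fun w hw => h.m2 hd hw hle
  have g2 : ∀ w, G.dist y w = 2 → G.dist x w = 3 := fun w hw => h.m2 hyx hw hle
  have f3 : ∀ w, G.dist x w = 3 → G.dist y w = 2 := by
    intro w hw
    obtain ⟨b, hwb, hb⟩ := h.pred hw
    exact h.m1 hd hb (f2 b hb) hwb.symm hw
  have g3 : ∀ w, G.dist y w = 3 → G.dist x w = 2 := by
    intro w hw
    obtain ⟨b, hwb, hb⟩ := h.pred hw
    exact h.m1 hyx hb (g2 b hb) hwb.symm hw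
  have f4 : ∀ w, G.dist x w = 4 → G.dist y w = 1 := by
    intro w hw
    obtain ⟨b, hwb, hb⟩ := h.pred hw
    have h1 := f3 b hb
    have h3 := g3 w
    rcases h.step y b w hwb.symm with h2 | h2 <;> omega
  have f5 : ∀ w, G.dist x w = 5 → G.dist y w = 0 := by
    intro w hw
    obtain ⟨b, hwb, hb⟩ := h.pred hw
    have h1 := f4 b hb
    have h3 := g2 w
    rcases h.step y b w hwb.symm with h2 | h2 <;> omega
  have hw := hle x w
  rcases (show G.dist x w = 0 ∨ G.dist x w = 1 ∨ G.dist x w = 2 ∨ G.dist x w = 3 ∨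
    G.dist x w = 4 ∨ G.dist x w = 5 by omega) with h0 | h0 | h0 | h0 | h0 | h0
  · have := h.d0.1 h0
    subst this
    omega
  · have := f1 w h0; omega
  · have := f2 w h0; omega
  · have := f3 w h0; omega
  · have := f4 w h0; omega
  · have := f5 w h0; omega

theorem prop (h : GoodGraph G m) {x y u : V} (hd : G.dist x y = 5)
    (hle : ∀ u w, G.dist u w ≤ 5) (hxu : G.Adj x u) : ∃ w, G.dist u w = 5 := by
  by_contra hno
  push Not at hno
  have A := h.anti hd hle
  have hyu : G.dist u y = 4 := by
    have := A u
    have := d1.2 hxu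
    rw [SimpleGraph.dist_comm]; omega
  have key := card_mul_le_card_mul (s := univ.filter (fun z => G.dist y z = 1))
    (t := univ.filter (fun z => G.dist u z = 2 ∧ G.dist y z = 2)) (m := m + 1) (n := m) G.Adj
    (by
      intro w hw
      simp only [mem_filter, mem_univ, true_and] at hw
      have huw : G.dist u w = 3 := by
        have := hno w
        rcases h.step u y w (d1.1 hw) with h2 | h2 <;> omega
      refine (h.c3 huw).trans ?_
      rw [bipartiteAbove, filter_filter]
      apply card_le_card
      intro t ht
      simp only [mem_filter, mem_univ, true_and] at ht ⊢
      refine ⟨⟨ht.2, ?_⟩, ht.1⟩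
      rcases h.step y w t ht.1 with h2 | h2
      · omega
      · have := h.d0.1 (show G.dist y t = 0 by omega)
        subst this
        omega)
    (by
      intro t ht
      simp only [mem_filter, mem_univ, true_and] at ht
      rw [← h.c2 ht.2, bipartiteBelow, filter_filter]
      simp only [and_comm, SimpleGraph.adj_comm, le_refl])
  rw [h.s1] at key
  have hs : (univ.filter (fun z => G.dist u z = 2 ∧ G.dist y z = 2)) ∪
      (univ.filter (fun z => G.dist x z = 1)).erase u ⊆ univ.filter (fun z => G.dist u z = 2) := by
    intro t ht
    simp only [mem_union, mem_erase, mem_filter, mem_univ, true_and] at ht ⊢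
    rcases ht with ht | ht
    · exact ht.1
    · exact h.d2 (Ne.symm ht.1) hxu.symm (d1.1 ht.2).symm
  have h3 := card_le_card hs
  rw [card_union_of_disjoint, card_erase_of_mem, h.s1, h.s2] at h3
  · have h4 : (univ.filter (fun z => G.dist u z = 2 ∧ G.dist y z = 2)).card ≤ 2 * m + 2 := by omega
    have := Nat.mul_le_mul_right m h4
    nlinarith
  · simp [d1, hxu]
  · rw [disjoint_left]
    intro z h1 h2
    simp only [mem_filter, mem_erase] at h1 h2
    have := A z
    omega

theorem all (h : GoodGraph G m) {x y : V} (hd : G.dist x y = 5)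
    (hle : ∀ u w, G.dist u w ≤ 5) (z : V) : ∃ w, G.dist z w = 5 := by
  have : ∀ (n : ℕ) (z : V), G.dist x z = n → ∃ w, G.dist z w = 5 := by
    intro n
    induction n with
    | zero =>
      intro z hz
      have := h.d0.1 hz
      subst this
      exact ⟨y, hd⟩
    | succ n ih =>
      intro z hz
      obtain ⟨t, hzt, ht⟩ := h.pred hz
      obtain ⟨w, hw⟩ := ih t ht
      exact h.prop hw hle hzt.symm
  exact this _ z rfl

theorem cc (h : GoodGraph G m) {x y z : V} (hd : G.dist x y = 5)
    (hle : ∀ u w, G.dist u w ≤ 5) (i : ℕ) (h1 : 1 ≤ i) (h5 : i ≤ 5) (hz : G.dist x z = i) :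
    (univ.filter (fun w => G.Adj z w ∧ G.dist x w = i - 1)).card = cArr (2 * m + 1) m i := by
  have A := h.anti hd hle
  have hAz := A z
  have tr : ∀ j, j ≤ 5 → univ.filter (fun w => G.Adj z w ∧ G.dist x w = j) =
      univ.filter (fun w => G.Adj z w ∧ G.dist y w = 5 - j) := by
    intro j hj
    ext w
    have := A w
    simp only [mem_filter, mem_univ, true_and, and_congr_right_iff]
    omega
  interval_cases i
  · exact h.c1 hz
  · exact h.c2 hz
  · rw [tr _ (by omega)]
    exact h.b2 (by omega)
  · rw [tr _ (by omega)]
    exact h.b1 (by omega)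
  · rw [tr _ (by omega)]
    have hyz := h.d0.1 (show G.dist y z = 0 by omega)
    subst hyz
    simp only [Nat.add_one_sub_one, Nat.reduceSub, d1, and_self]
    exact h.deg y

theorem bb (h : GoodGraph G m) {x y z : V} (hd : G.dist x y = 5)
    (hle : ∀ u w, G.dist u w ≤ 5) (i : ℕ) (h5 : i ≤ 4) (hz : G.dist x z = i) :
    (univ.filter (fun w => G.Adj z w ∧ G.dist x w = i + 1)).card = bArr (2 * m + 1) m i := by
  rcases Nat.eq_zero_or_pos i with rfl | hi
  · have hyz := h.d0.1 hz
    subst hyz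
    simp only [zero_add, d1, and_self]
    exact h.deg x
  · have h1 := h.cc hd hle i hi (by omega) hz
    obtain ⟨j, rfl⟩ : ∃ j, i = j + 1 := ⟨i - 1, by omega⟩
    have h2 := h.split j hz
    simp only [Nat.add_sub_cancel] at h1
    have h4 : cArr (2 * m + 1) m (j + 1) + bArr (2 * m + 1) m (j + 1) = 2 * m + 1 := by
      have : j ≤ 3 := by omega
      interval_cases j <;> simp [cArr, bArr] <;> omega
    rw [show j + 1 + 1 = j + 2 from rfl]
    omega

theorem total (h : GoodGraph G m) {x y : V} (hd : G.dist x y = 5)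
    (hle : ∀ u w, G.dist u w ≤ 5) : Fintype.card V = 6 * (2 * m + 1) + 2 := by
  have A := h.anti hd hle
  have tr : ∀ j, j ≤ 5 → univ.filter (fun w => G.dist x w = j) =
      univ.filter (fun w => G.dist y w = 5 - j) := by
    intro j hj
    ext w
    have := A w
    simp only [mem_filter, mem_univ, true_and]
    omega
  have s0 : ∀ x : V, (univ.filter (fun w => G.dist x w = 0)).card = 1 := by
    intro x
    rw [card_eq_one]
    refine ⟨x, ?_⟩
    ext w
    simp [h.d0, eq_comm]
  have key := card_eq_sum_card_fiberwise (s := (univ : Finset V)) (t := range 6)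
    (f := fun w => G.dist x w) (by
      intro w _
      have := hle x w
      simp only [coe_range, Set.mem_Iio]
      omega)
  rw [card_univ] at key
  rw [key]
  simp only [sum_range_succ, range_zero, sum_empty]
  rw [tr 3 (by omega), tr 4 (by omega), tr 5 (by omega), s0, h.s1, h.s2]
  simp only [Nat.reduceSub]
  rw [s0, h.s1, h.s2]
  ring

end GoodGraph

/-- Let `Γ` be a connected bipartite amply regular graph with diameter `5` and parameters
`(v, k, 0, (k-1)/2)`, where `k ≥ 5` is odd.  Then `v = 6k + 2` and `Γ` is distance-regular
with intersection array `(k, k-1, (k+1)/2, (k-1)/2, 1; 1, (k-1)/2, (k+1)/2, k-1, k)`. -/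
theorem stmt6 {V : Type*} [Fintype V] (G : SimpleGraph V) (v k μ : ℕ)
    (hG : IsAmplyRegular G v k 0 μ) (hconn : G.Connected) (hbip : IsBipartiteGraph G)
    (hk5 : 5 ≤ k) (hkodd : Odd k) (hμ : 2 * μ = k - 1)
    (hdiam : G.diam = 5) :
    v = 6 * k + 2 ∧
    (∀ x y : V, ∀ i : ℕ, 1 ≤ i → i ≤ 5 → G.dist x y = i →
      {z : V | G.Adj y z ∧ G.dist x z = i - 1}.ncard = cArr k μ i) ∧
    (∀ x y : V, ∀ i : ℕ, i ≤ 4 → G.dist x y = i →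
      {z : V | G.Adj y z ∧ G.dist x z = i + 1}.ncard = bArr k μ i) := by
  classical
  obtain ⟨hv, hdeg, hlam, hcom⟩ := hG
  have hk : k = 2 * μ + 1 := by omega
  subst hk
  obtain ⟨X, hX⟩ := hbip
  have hwalk : ∀ (a b : V) (p : G.Walk a b), (Even p.length ↔ (a ∈ X ↔ b ∈ X)) := by
    intro a b p
    induction p with
    | nil => simp
    | cons hadj q ih =>
      have := hX hadj
      rw [SimpleGraph.Walk.length_cons, Nat.even_add_one, ih]
      tauto
  have hpar : ∀ a b : V, (Even (G.dist a b) ↔ (a ∈ X ↔ b ∈ X)) := by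
    intro a b
    obtain ⟨p, hp⟩ := hconn.exists_walk_length_eq_dist a b
    rw [← hp]
    exact hwalk a b p
  have hg : GoodGraph G μ := by
    refine ⟨hconn, by omega, ?_, ?_, ?_⟩
    · intro x u w huw
      have h1 : G.dist x w ≤ G.dist x u + G.dist u w := hconn.dist_triangle
      have h2 : G.dist x u ≤ G.dist x w + G.dist w u := hconn.dist_triangle
      rw [SimpleGraph.dist_eq_one_iff_adj.2 huw] at h1
      rw [SimpleGraph.dist_eq_one_iff_adj.2 huw.symm] at h2
      have h3 : G.dist x u ≠ G.dist x w := by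
        intro h4
        have h5 := hpar x u
        have h6 := hpar x w
        rw [h4] at h5
        have := hX huw
        tauto
      omega
    · intro x
      rw [← hdeg x, ← Set.ncard_coe_finset]
      congr 1
      ext z
      simp
    · intro x y hxy
      rw [← hcom x y hxy, ← Set.ncard_coe_finset]
      congr 1
      ext z
      simp [SimpleGraph.mem_commonNeighbors]
  have hne : Nonempty V := hconn.nonempty
  have htop : G.ediam ≠ ⊤ := by
    intro h1
    have : G.diam = 0 := by simp [SimpleGraph.diam, h1]
    omega
  have hle : ∀ u w, G.dist u w ≤ 5 := fun u w => hdiam ▸ SimpleGraph.dist_le_diam htop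
  obtain ⟨x, y, hxy⟩ := G.exists_dist_eq_diam
  rw [hdiam] at hxy
  refine ⟨?_, ?_, ?_⟩
  · rw [← hv]
    exact hg.total hxy hle
  · intro a b i h1 h5 hi
    obtain ⟨w, hw⟩ := hg.all hxy hle a
    rw [← hg.cc hw hle i h1 h5 hi, ← Set.ncard_coe_finset]
    congr 1
    ext z
    simp
  · intro a b i h5 hi
    obtain ⟨w, hw⟩ := hg.all hxy hle a
    rw [← hg.bb hw hle i h5 hi, ← Set.ncard_coe_finset]
    congr 1
    ext z
    simp
end

section
/- Let Γ be a connected amply regular graph with diameter 4 and parameters (v, k, 0, (k − 1)/2), where k ≥ 5 is odd. Then Γ is bipartite. -/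
/-- Abstract metric form of the hypotheses. -/
structure AR {V : Type*} [Fintype V] (d : V → V → ℕ) (μ : ℕ) : Prop where
  symm : ∀ x y, d x y = d y x
  tri : ∀ x y z, d x z ≤ d x y + d y z
  zero : ∀ x y, d x y = 0 ↔ x = y
  step : ∀ x z n, d x z = n + 1 → ∃ w, d x w = n ∧ d w z = 1
  deg : ∀ x, (Finset.univ.filter (fun t => d x t = 1)).card = 2 * μ + 1
  notri : ∀ x y z, d x y = 1 → d y z = 1 → d x z ≠ 1
  mu : ∀ x y, d x y = 2 → (Finset.univ.filter (fun t => d x t = 1 ∧ d y t = 1)).card = μ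
  two : 2 ≤ μ
  diam : ∀ x y, d x y ≤ 4

namespace AR

lemma card_add_le {V : Type*} [Fintype V] (p q r : V → Prop)
    [DecidablePred p] [DecidablePred q] [DecidablePred r]
    (hp : ∀ t, p t → r t) (hq : ∀ t, q t → r t) (hpq : ∀ t, p t → ¬ q t) :
    (Finset.univ.filter p).card + (Finset.univ.filter q).card ≤ (Finset.univ.filter r).card := by
  classical
  rw [← Finset.card_union_of_disjoint]
  · apply Finset.card_le_card
    intro t
    simp only [Finset.mem_union, Finset.mem_filter, Finset.mem_univ, true_and]
    rintro (h | h)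
    · exact hp t h
    · exact hq t h
  · rw [Finset.disjoint_filter]
    intro t _ h
    exact hpq t h

lemma card_add3_le {V : Type*} [Fintype V] (p q s r : V → Prop)
    [DecidablePred p] [DecidablePred q] [DecidablePred r] [DecidablePred s]
    (hp : ∀ t, p t → r t) (hq : ∀ t, q t → r t) (hs : ∀ t, s t → r t)
    (hpq : ∀ t, p t → ¬ q t) (hps : ∀ t, p t → ¬ s t) (hqs : ∀ t, q t → ¬ s t) :
    (Finset.univ.filter p).card + (Finset.univ.filter q).card + (Finset.univ.filter s).card
      ≤ (Finset.univ.filter r).card := by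
  classical
  have h1 := card_add_le p q (fun t => p t ∨ q t) (by tauto) (by tauto) hpq
  have h2 := card_add_le (fun t => p t ∨ q t) s r (by grind) hs (by grind)
  omega

lemma card_mono {V : Type*} [Fintype V] (p r : V → Prop)
    [DecidablePred p] [DecidablePred r] (hp : ∀ t, p t → r t) :
    (Finset.univ.filter p).card ≤ (Finset.univ.filter r).card := by
  apply Finset.card_le_card
  intro t
  simpa using hp t

variable {V : Type*} [Fintype V] {d : V → V → ℕ} {μ : ℕ}

/-- distance two from a common neighbour. -/
lemma two_of (h : AR d μ) {x y t : V} (hne : x ≠ y) (h1 : d x t = 1) (h2 : d t y = 1) :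
    d x y = 2 := by
  have := h.tri x t y
  have := h.notri x t y h1 h2
  have := (h.zero x y).not.mpr hne
  omega

lemma ex_mu (h : AR d μ) {x y : V} (hd : d x y = 2) (a : V) :
    ∃ t, t ≠ a ∧ d x t = 1 ∧ d y t = 1 := by
  have h1 : 1 < (Finset.univ.filter (fun t => d x t = 1 ∧ d y t = 1)).card := by
    rw [h.mu x y hd]; exact h.two
  obtain ⟨t, ht, hta⟩ := Finset.exists_mem_ne h1 a
  exact ⟨t, hta, by simpa using ht⟩

lemma c3 (h : AR d μ) {x z : V} (hd : d x z = 3) :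
    μ + 1 ≤ (Finset.univ.filter (fun t => d z t = 1 ∧ d x t = 2)).card := by
  by_contra hlt
  have key : ∀ u, d x u = 1 → d u z = 2 → ∀ t, d z t = 1 ∧ d x t = 2 → d u t = 1 := by
    intro u hu huz
    have hsub : (Finset.univ.filter (fun t => d u t = 1 ∧ d z t = 1)) ⊆
        (Finset.univ.filter (fun t => d z t = 1 ∧ d x t = 2)) := by
      intro t
      simp only [Finset.mem_filter, Finset.mem_univ, true_and]
      rintro ⟨h1, h2⟩
      have := h.tri x u t
      have := h.tri x t z
      have := h.symm t z
      omega
    have heq := Finset.eq_of_subset_of_card_le hsub (by rw [h.mu u z huz]; omega)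
    intro t ht
    have : t ∈ (Finset.univ.filter (fun t => d u t = 1 ∧ d z t = 1)) := by
      rw [heq]; simpa using ht
    simp at this
    exact this.1
  obtain ⟨b, hb, hbz⟩ := h.step x z 2 hd
  have near : ∀ u, d x u = 1 → d b u = 1 → d u z = 2 := by
    intro u h1 h2
    have := h.tri x u z
    have := h.tri u b z
    have := h.symm u b
    omega
  obtain ⟨u, -, hu1, hu2⟩ := h.ex_mu hb x
  obtain ⟨u', hne, hu1', hu2'⟩ := h.ex_mu hb u
  have k1 := key u hu1 (near u hu1 hu2)
  have k2 := key u' hu1' (near u' hu1' hu2')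
  have hB : μ ≤ (Finset.univ.filter (fun t => d z t = 1 ∧ d x t = 2)).card := by
    rw [← h.mu u z (near u hu1 hu2)]
    apply card_mono
    rintro t ⟨h1, h2⟩
    have := h.tri x u t
    have := h.tri x t z
    have := h.symm t z
    omega
  have hx : 1 ≤ (Finset.univ.filter (fun t => d x t = 0)).card := by
    apply Finset.card_pos.mpr
    exact ⟨x, by simp [h.zero]⟩
  have huu : d u u' = 2 := h.two_of hne.symm (by rw [h.symm]; exact hu1) hu1'
  have := card_add_le (fun t => d z t = 1 ∧ d x t = 2) (fun t => d x t = 0)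
    (fun t => d u t = 1 ∧ d u' t = 1) (fun t ht => ⟨k1 t ht, k2 t ht⟩)
    (by
      intro t ht
      have : x = t := (h.zero _ _).mp ht
      subst this
      exact ⟨by rw [h.symm]; exact hu1, by rw [h.symm]; exact hu1'⟩)
    (by omega)
  rw [h.mu u u' huu] at this
  omega

/-- Three vertices at distance two from `f` cannot have disjoint sets of common neighbours. -/
lemma three (h : AR d μ) {f a b c : V} (ha : d a f = 2) (hb : d b f = 2) (hc : d c f = 2)
    (hab : ∀ t, d f t = 1 → d a t = 1 → d b t ≠ 1)
    (hac : ∀ t, d f t = 1 → d a t = 1 → d c t ≠ 1)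
    (hbc : ∀ t, d f t = 1 → d b t = 1 → d c t ≠ 1) : False := by
  have := card_add3_le (fun t => d a t = 1 ∧ d f t = 1) (fun t => d b t = 1 ∧ d f t = 1)
    (fun t => d c t = 1 ∧ d f t = 1) (fun t => d f t = 1) (by tauto) (by tauto) (by tauto)
    (by grind) (by grind) (by grind)
  rw [h.mu _ _ ha, h.mu _ _ hb, h.mu _ _ hc, h.deg] at this
  have := h.two
  omega

/-- neighbours of `u` at distance two from `x`, where `u` is a neighbour of `x`. -/
lemma b1 (h : AR d μ) {x u : V} (hu : d x u = 1) :
    (Finset.univ.filter (fun t => d x t = 2 ∧ d u t = 1)).card = 2 * μ := by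
  classical
  have hx : (Finset.univ.filter (fun t => d x t = 2 ∧ d u t = 1)) =
      (Finset.univ.filter (fun t => d u t = 1)).erase x := by
    ext t
    simp only [Finset.mem_filter, Finset.mem_univ, true_and, Finset.mem_erase]
    constructor
    · rintro ⟨h1, h2⟩
      refine ⟨?_, h2⟩
      rintro rfl
      have := (h.zero t t).mpr rfl
      omega
    · rintro ⟨h1, h2⟩
      exact ⟨h.two_of h1.symm hu h2, h2⟩
  rw [hx, Finset.card_erase_of_mem, h.deg]
  · omega
  · simpa [h.symm u x] using hu

lemma k2 (h : AR d μ) (x : V) :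
    (Finset.univ.filter (fun t => d x t = 2)).card = 4 * μ + 2 := by
  classical
  have := Finset.sum_card_bipartiteAbove_eq_sum_card_bipartiteBelow
    (s := Finset.univ.filter (fun t => d x t = 1)) (t := Finset.univ.filter (fun t => d x t = 2))
    (fun a b => d a b = 1)
  rw [Finset.sum_const_nat (m := 2 * μ), Finset.sum_const_nat (m := μ), h.deg] at this
  · have h2 := h.two
    have : μ * (Finset.univ.filter (fun t => d x t = 2)).card = μ * (4 * μ + 2) := by
      rw [mul_comm, ← this]; ring
    exact Nat.eq_of_mul_eq_mul_left (by omega) this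
  · intro f hf
    simp only [Finset.mem_filter, Finset.mem_univ, true_and] at hf
    rw [← h.mu x f hf, Finset.bipartiteBelow, Finset.filter_filter]
    simp only [h.symm f]
  · intro u hu
    simp only [Finset.mem_filter, Finset.mem_univ, true_and] at hu
    rw [← h.b1 hu, Finset.bipartiteAbove, Finset.filter_filter]

lemma C_ge (h : AR d μ) {x y : V} (hd : d x y = 4) :
    μ + 1 ≤ (Finset.univ.filter (fun t => d x t = 1 ∧ d y t = 3)).card := by
  obtain ⟨e, he, hey⟩ := h.step x y 3 hd
  refine (h.c3 (x := e) (z := x) (by rw [h.symm]; exact he)).trans (card_mono _ _ ?_)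
  rintro t ⟨h1, h2⟩
  have := h.tri y e t
  have := h.tri x t y
  have := h.symm t y
  have := h.symm y e
  omega

lemma F_count (h : AR d μ) {x y : V} (hd : d x y = 4) :
    (Finset.univ.filter (fun t => d x t = 1 ∧ d y t = 3)).card * (μ + 1) ≤
    (Finset.univ.filter (fun t => d x t = 2 ∧ d y t = 2)).card * μ := by
  classical
  refine Finset.card_mul_le_card_mul (fun a b => d a b = 1) ?_ ?_
  · intro u hu
    simp only [Finset.mem_filter, Finset.mem_univ, true_and] at hu
    rw [Finset.bipartiteAbove, Finset.filter_filter]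
    refine (h.c3 hu.2).trans (card_mono _ _ ?_)
    rintro t ⟨h1, h2⟩
    have := h.tri x u t
    have := h.tri x t y
    have := h.symm t y
    omega
  · intro f hf
    simp only [Finset.mem_filter, Finset.mem_univ, true_and] at hf
    rw [Finset.bipartiteBelow, Finset.filter_filter, ← h.mu x f hf.1]
    apply card_mono
    rintro t ⟨⟨h1, h2⟩, h3⟩
    exact ⟨h1, by rw [h.symm]; exact h3⟩

lemma F_ge (h : AR d μ) {x y : V} (hd : d x y = 4) :
    2 * μ + 2 ≤ (Finset.univ.filter (fun t => d x t = 2 ∧ d y t = 2)).card := by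
  classical
  have hF := h.F_count hd
  have hC := h.C_ge hd
  have h2 := h.two
  by_cases hbig : 2 * μ ≤ (Finset.univ.filter (fun t => d x t = 1 ∧ d y t = 3)).card
  · by_contra hlt
    nlinarith
  exfalso
  have hsplit : (Finset.univ.filter (fun t => d x t = 1)).card ≤
      (Finset.univ.filter (fun t => d x t = 1 ∧ d y t = 3)).card +
      (Finset.univ.filter (fun t => d x t = 1 ∧ d y t ≠ 3)).card := by
    rw [← Finset.filter_filter, ← Finset.filter_filter, Finset.card_filter_add_card_filter_not]
  rw [h.deg] at hsplit
  have : 1 < (Finset.univ.filter (fun t => d x t = 1 ∧ d y t ≠ 3)).card := by omega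
  obtain ⟨u0, hu0, u1, hu1, hne⟩ := Finset.one_lt_card.mp this
  simp only [Finset.mem_filter, Finset.mem_univ, true_and] at hu0 hu1
  have far : ∀ u f, d x u = 1 → d y u ≠ 3 → d y f = 2 → d u f ≠ 1 := by
    intro u f h1 h3 h4 h5
    have := h.tri y f u
    have := h.tri x u y
    have := h.symm u y
    have := h.symm u f
    omega
  have huu : d u0 u1 = 2 := h.two_of hne (by rw [h.symm]; exact hu0.1) hu1.1
  have e0 := h.b1 hu0.1
  have e1 := h.b1 hu1.1
  have hm := h.mu u0 u1 huu
  have hin : (Finset.univ.filter (fun t => d x t = 2 ∧ d u0 t = 1 ∧ d u1 t = 1)).card + 1 ≤ μ := by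
    have hx : 1 ≤ (Finset.univ.filter (fun t => d x t = 0)).card :=
      Finset.card_pos.mpr ⟨x, by simp [h.zero]⟩
    have := card_add_le (fun t => d x t = 2 ∧ d u0 t = 1 ∧ d u1 t = 1) (fun t => d x t = 0)
      (fun t => d u0 t = 1 ∧ d u1 t = 1) (by tauto)
      (by
        intro t ht
        have : x = t := (h.zero _ _).mp ht
        subst this
        exact ⟨by rw [h.symm]; exact hu0.1, by rw [h.symm]; exact hu1.1⟩)
      (by omega)
    omega
  have e1' : (Finset.univ.filter (fun t => d x t = 2 ∧ d u1 t = 1)).card =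
      (Finset.univ.filter (fun t => d x t = 2 ∧ d u0 t = 1 ∧ d u1 t = 1)).card +
      (Finset.univ.filter (fun t => d x t = 2 ∧ d u0 t ≠ 1 ∧ d u1 t = 1)).card := by
    rw [← Finset.card_filter_add_card_filter_not (fun t => d u0 t = 1),
      Finset.filter_filter, Finset.filter_filter]
    congr 2 <;> (ext t; simp; tauto)
  have tot := card_add3_le (fun t => d x t = 2 ∧ d u0 t = 1)
    (fun t => d x t = 2 ∧ d u0 t ≠ 1 ∧ d u1 t = 1) (fun t => d x t = 2 ∧ d y t = 2)
    (fun t => d x t = 2) (by tauto) (by tauto) (by tauto) (by tauto)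
    (fun t a b => far u0 t hu0.1 hu0.2 b.2 a.2)
    (fun t a b => far u1 t hu1.1 hu1.2 b.2 a.2.2)
  rw [h.k2] at tot
  have hf : (Finset.univ.filter (fun t => d x t = 2 ∧ d y t = 2)).card ≤ μ + 1 := by omega
  nlinarith

lemma D4 (h : AR d μ) {x u y : V} (hxu : d x u = 1) (hx : d x y = 4) (hu : d u y = 4) :
    False := by
  have f1 := h.F_ge hx
  have f2 := h.F_ge hu
  have := card_add_le (fun t => d x t = 2 ∧ d y t = 2) (fun t => d u t = 2 ∧ d y t = 2)
    (fun t => d y t = 2) (by tauto) (by tauto) (by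
      rintro f ⟨h1, h2⟩ ⟨h3, -⟩
      refine h.three h1 h2 h3 ?_ ?_ ?_
      · intro t _ a b
        have := h.tri x t y
        have := h.symm t y
        omega
      · intro t _ a b
        have := h.symm u t
        exact h.notri x t u a (by omega) hxu
      · intro t _ a b
        have := h.tri u t y
        have := h.symm t y
        omega)
  rw [h.k2] at this
  omega

lemma nb3 (h : AR d μ) {x u y : V} (hd : d x y = 4) (hxu : d x u = 1) : d u y = 3 := by
  have := h.tri x u y
  have := h.diam u y
  have : d u y ≠ 4 := fun h' => h.D4 hxu hd h'
  omega

lemma F_nb (h : AR d μ) {x y f w : V} (hd : d x y = 4) (hf : d x f = 2) (hf' : d y f = 2)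
    (hfw : d f w = 1) (hw : d x w = 2) : False := by
  obtain ⟨u, -, hu, hwu⟩ := h.ex_mu hw x
  have hu3 := h.nb3 hd hu
  have hne : u ≠ f := by
    rintro rfl; omega
  have huf : d u f = 2 := h.two_of (t := w) hne (by rw [h.symm]; exact hwu) (by rw [h.symm]; exact hfw)
  refine h.three hf hf' huf ?_ ?_ ?_
  · intro t _ a b
    have := h.tri x t y
    have := h.symm t y
    omega
  · intro t _ a b
    have := h.symm u t
    exact h.notri x t u a (by omega) hu
  · intro t _ a b
    have := h.tri u t y
    have := h.symm t y
    omega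

lemma D2_aux (h : AR d μ) {x y w w' : V} (hd : d x y = 4) (hw : d x w = 2) (hw' : d x w' = 2)
    (hww : d w w' = 1) : d w y = 4 := by
  have h1 := h.tri x w y
  have h2 := h.diam w y
  have h3 : d w y ≠ 2 := fun h' => h.F_nb hd hw (by rw [h.symm]; exact h') hww hw'
  by_contra h4
  have hwy : d y w = 3 := by rw [h.symm]; omega
  obtain ⟨u, -, hu, hwu⟩ := h.ex_mu hw' x
  have huw : d u w = 2 := h.two_of (t := w') (by rintro rfl; omega) (by rw [h.symm]; exact hwu)
    (by rw [h.symm]; exact hww)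
  have c := h.c3 hwy
  have := card_add3_le (fun t => d x t = 1 ∧ d w t = 1) (fun t => d u t = 1 ∧ d w t = 1)
    (fun t => d w t = 1 ∧ d y t = 2) (fun t => d w t = 1) (by tauto) (by tauto) (by tauto)
    (by
      rintro t ⟨a, -⟩ ⟨b, -⟩
      exact h.notri x u t hu b a)
    (by
      rintro t ⟨a, -⟩ ⟨-, b⟩
      have := h.nb3 hd a
      have := h.symm t y
      omega)
    (by
      rintro t ⟨a, b⟩ ⟨-, c⟩
      have := h.tri x t y
      have := h.symm t y
      have := h.tri x u t
      exact h.F_nb hd (f := t) (w := w) (by omega) c (by rw [h.symm]; exact b) hw)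
  rw [h.mu _ _ hw, h.mu _ _ huw, h.deg] at this
  have := h.two
  omega

lemma D2 (h : AR d μ) {x y w w' : V} (hd : d x y = 4) (hw : d x w = 2) (hw' : d x w' = 2)
    (hww : d w w' = 1) : False :=
  h.D4 hww (h.D2_aux hd hw hw' hww) (h.D2_aux hd hw' hw (by rw [h.symm]; exact hww))

lemma D3 (h : AR d μ) {x y z z' : V} (hd : d x y = 4) (hz : d x z = 3) (hz' : d x z' = 3)
    (hzz : d z z' = 1) : False := by
  classical
  have B := h.c3 hz
  have B' := h.c3 hz'
  have dist : ∀ w, d z' w = 1 ∧ d x w = 2 → d z w = 2 := by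
    rintro w ⟨h1, h2⟩
    exact h.two_of (t := z') (by rintro rfl; omega) hzz h1
  have key : ∀ w, d z' w = 1 ∧ d x w = 2 → ∀ t, d z t = 1 → d x t ≠ 2 → d w t = 1 := by
    intro w hw t ht hxt
    by_contra hwt
    have h1 : 1 ≤ (Finset.univ.filter (fun s => s = t)).card :=
      Finset.card_pos.mpr ⟨t, by simp⟩
    have := card_add3_le (fun s => d z s = 1 ∧ d x s = 2) (fun s => d z s = 1 ∧ d w s = 1)
      (fun s => s = t) (fun s => d z s = 1) (by tauto) (by tauto) (by rintro s rfl; exact ht)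
      (by
        rintro s ⟨-, a⟩ ⟨-, b⟩
        exact h.D2 hd hw.2 a b)
      (by rintro s ⟨-, a⟩ rfl; exact hxt a)
      (by rintro s ⟨-, a⟩ rfl; exact hwt a)
    rw [h.mu _ _ (dist w hw), h.deg] at this
    omega
  obtain ⟨w0, h0⟩ : ∃ w0, d z' w0 = 1 ∧ d x w0 = 2 := by
    obtain ⟨w0, a, b⟩ := h.step x z' 2 hz'
    exact ⟨w0, by rw [h.symm]; exact b, a⟩
  obtain ⟨t, hne, ht, ht'⟩ := h.ex_mu (dist w0 h0) z'
  have hxt : d x t ≠ 2 := fun a => h.D2 hd h0.2 a ht'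
  have htz : d t z' = 2 := h.two_of (t := z) hne (by rw [h.symm]; exact ht) hzz
  have := card_mono (fun w => d z' w = 1 ∧ d x w = 2) (fun w => d t w = 1 ∧ d z' w = 1)
    (fun w hw => ⟨by rw [h.symm]; exact key w hw t ht hxt, hw.1⟩)
  rw [h.mu _ _ htz] at this
  omega

lemma level (h : AR d μ) {x y a b : V} (hd : d x y = 4) (hab : d a b = 1) : d x a ≠ d x b := by
  intro he
  have := h.diam x a
  have h0 : d x a = 0 ∨ d x a = 1 ∨ d x a = 2 ∨ d x a = 3 ∨ d x a = 4 := by omega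
  rcases h0 with h0 | h0 | h0 | h0 | h0
  · have e1 := (h.zero _ _).mp h0
    have e2 := (h.zero _ _).mp (he ▸ h0)
    have := (h.zero a b).mpr (e1.symm.trans e2)
    omega
  · exact h.notri x a b h0 hab (he ▸ h0)
  · exact h.D2 hd h0 (he ▸ h0) hab
  · exact h.D3 hd h0 (he ▸ h0) hab
  · exact h.D4 hab (by rw [h.symm]; exact h0) (by rw [h.symm]; exact he ▸ h0)

end AR

/-- Let `Γ` be a connected amply regular graph with diameter `4` and parameters
`(v, k, 0, (k-1)/2)`, where `k ≥ 5` is odd.  Then `Γ` is bipartite. -/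
theorem stmt7 {V : Type*} [Fintype V] (G : SimpleGraph V) (v k μ : ℕ)
    (hG : IsAmplyRegular G v k 0 μ) (hconn : G.Connected)
    (hk5 : 5 ≤ k) (hkodd : Odd k) (hμ : 2 * μ = k - 1)
    (hdiam : G.diam = 4) :
    IsBipartiteGraph G := by
  classical
  obtain ⟨-, hdeg, hl, hm⟩ := hG
  have hdist1 : ∀ x y, G.dist x y = 1 ↔ G.Adj x y := fun x y => SimpleGraph.dist_eq_one_iff_adj
  have hnt : Nonempty V := hconn.nonempty
  have hAR : AR G.dist μ := by
    refine ⟨fun x y => SimpleGraph.dist_comm, fun x y z => hconn.dist_triangle,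
      fun x y => hconn.dist_eq_zero_iff, ?_, ?_, ?_, ?_, by omega, ?_⟩
    · intro x z n hn
      obtain ⟨p, hp⟩ := hconn.exists_walk_length_eq_dist x z
      have hnn : ¬ p.Nil := by
        intro hnil
        have := SimpleGraph.Walk.nil_iff_length_eq.mp hnil
        omega
      have hadj := p.adj_penultimate hnn
      have h1 := SimpleGraph.dist_le p.dropLast
      have h2 : p.dropLast.length + 1 = p.length := by
        simp
        omega
      refine ⟨p.penultimate, ?_, (hdist1 _ _).mpr hadj⟩
      have h3 := hconn.dist_triangle (u := x) (v := p.penultimate) (w := z)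
      have h4 := (hdist1 _ _).mpr hadj
      omega
    · intro x
      have := hdeg x
      rw [Set.ncard_eq_toFinset_card'] at this
      have e : (Finset.univ.filter (fun t => G.dist x t = 1)) = (G.neighborSet x).toFinset := by
        ext t; simp [hdist1]
      rw [e, this]
      omega
    · intro x y z h1 h2 h3
      rw [hdist1] at h1 h2 h3
      have := hl x z h3
      rw [Set.ncard_eq_zero] at this
      have hy : y ∈ G.commonNeighbors x z := ⟨h1, h2.symm⟩
      rw [this] at hy
      exact hy
    · intro x y hxy
      have := hm x y hxy
      rw [Set.ncard_eq_toFinset_card'] at this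
      rw [← this]
      congr 1
      ext t; simp [hdist1, SimpleGraph.mem_commonNeighbors]
    · intro x y
      rw [← hdiam]
      exact SimpleGraph.dist_le_diam (by
        intro htop
        rw [SimpleGraph.diam, htop] at hdiam
        simp at hdiam)
  obtain ⟨x, y, hxy⟩ := G.exists_dist_eq_diam
  rw [hdiam] at hxy
  refine ⟨{z | Even (G.dist x z)}, ?_⟩
  intro a b hab
  have hab1 := (hdist1 a b).mpr hab
  have hne := hAR.level hxy hab1
  have t1 := hAR.tri x a b
  have t2 := hAR.tri x b a
  have t3 := hAR.symm a b
  simp only [Set.mem_setOf_eq, Nat.even_iff]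
  omega
end

section
/- Let n ≥ 5 be an integer with n ≡ 3 (mod 4), and let A be an n × n integer matrix with all entries in {0, 1}, zero diagonal, satisfying A + Aᵀ = J − I and A·Aᵀ = ((n−1)/2)·I + ((n−3)/4)·(J − I), where J is the all-ones matrix and I the identity. Let C₁ be the (2n+2) × (2n+2) matrix written in blocks of sizes 1, n, n, 1 as C₁ = [[0, 𝟏, 0, 0], [0, A, Aᵀ, 𝟏ᵀ], [𝟏ᵀ, Aᵀ, A, 0], [0, 0, 𝟏, 0]], where 𝟏 denotes the all-ones row vector of length n, and let B = [[0, C₁], [C₁ᵀ, 0]] (a (4n+4) × (4n+4) matrix in 2 × 2 block form). Then B is symmetric with entries in {0, 1} and zero diagonal, so it is the adjacency matrix of a simple graph Γ on 4n + 4 vertices, and Γ is a connected bipartite amply regular graph with diameter 4 and parameters (4n+4, n, 0, (n−1)/2). -/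
open Matrix

/-- The index type for the `(2n+2) × (2n+2)` matrix `C₁`, split into blocks of sizes
`1, n, n, 1`. -/
abbrev BVert (n : ℕ) := Unit ⊕ Fin n ⊕ Fin n ⊕ Unit

/-- The all-ones `n × n` integer matrix `J`. -/
def allOnes (n : ℕ) : Matrix (Fin n) (Fin n) ℤ := Matrix.of fun _ _ => 1

/-- The block matrix `C₁ = [[0, 𝟏, 0, 0], [0, A, Aᵀ, 𝟏ᵀ], [𝟏ᵀ, Aᵀ, A, 0], [0, 0, 𝟏, 0]]`
with blocks of sizes `1, n, n, 1`. -/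
def C1mat {n : ℕ} (A : Matrix (Fin n) (Fin n) ℤ) : Matrix (BVert n) (BVert n) ℤ :=
  Matrix.of fun i j =>
    match i, j with
    | Sum.inl _, Sum.inl _ => 0
    | Sum.inl _, Sum.inr (Sum.inl _) => 1
    | Sum.inl _, Sum.inr (Sum.inr _) => 0
    | Sum.inr (Sum.inl _), Sum.inl _ => 0
    | Sum.inr (Sum.inl a), Sum.inr (Sum.inl b) => A a b
    | Sum.inr (Sum.inl a), Sum.inr (Sum.inr (Sum.inl b)) => A b a
    | Sum.inr (Sum.inl _), Sum.inr (Sum.inr (Sum.inr _)) => 1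
    | Sum.inr (Sum.inr (Sum.inl _)), Sum.inl _ => 1
    | Sum.inr (Sum.inr (Sum.inl a)), Sum.inr (Sum.inl b) => A b a
    | Sum.inr (Sum.inr (Sum.inl a)), Sum.inr (Sum.inr (Sum.inl b)) => A a b
    | Sum.inr (Sum.inr (Sum.inl _)), Sum.inr (Sum.inr (Sum.inr _)) => 0
    | Sum.inr (Sum.inr (Sum.inr _)), Sum.inr (Sum.inr (Sum.inl _)) => 1
    | Sum.inr (Sum.inr (Sum.inr _)), _ => 0

/-- The matrix `B = [[0, C₁], [C₁ᵀ, 0]]`. -/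
def Bmat {n : ℕ} (A : Matrix (Fin n) (Fin n) ℤ) :
    Matrix (BVert n ⊕ BVert n) (BVert n ⊕ BVert n) ℤ :=
  Matrix.fromBlocks 0 (C1mat A) (C1mat A)ᵀ 0

namespace Aux15

lemma sums (n : ℕ) (hn3 : n % 4 = 3)
    (A : Matrix (Fin n) (Fin n) ℤ)
    (hA01 : ∀ i j, A i j = 0 ∨ A i j = 1)
    (hAsum : A + Aᵀ = allOnes n - 1)
    (hAprod : A * Aᵀ = (((n - 1) / 2 : ℕ) : ℤ) • (1 : Matrix (Fin n) (Fin n) ℤ) +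
      (((n - 3) / 4 : ℕ) : ℤ) • (allOnes n - 1)) :
    ∃ k : ℤ, (n : ℤ) = 4 * k + 3 ∧ (((n - 1) / 2 : ℕ) : ℤ) = 2 * k + 1 ∧
    (∀ a, ∑ c, A a c = 2 * k + 1) ∧ (∀ a, ∑ c, A c a = 2 * k + 1) ∧
    (∀ a b, ∑ c, A a c * A b c = if a = b then 2 * k + 1 else k) ∧
    (∀ a b, ∑ c, A c a * A c b = if a = b then 2 * k + 1 else k) ∧
    (∀ a b, ∑ c, A a c * A c b = if a = b then 0 else k + 1 - A a b) := by
  have h1 : (((n - 1) / 2 : ℕ) : ℤ) = 2 * ((n / 4 : ℕ) : ℤ) + 1 := by omega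
  have h2 : (((n - 3) / 4 : ℕ) : ℤ) = ((n / 4 : ℕ) : ℤ) := by omega
  have h3 : (n : ℤ) = 4 * ((n / 4 : ℕ) : ℤ) + 3 := by omega
  rw [h1, h2] at hAprod
  generalize ((n / 4 : ℕ) : ℤ) = k at *
  have hs : ∀ a b, A b a = 1 - (if a = b then 1 else 0) - A a b := by
    intro a b
    have := congrFun (congrFun hAsum a) b
    simp [allOnes, Matrix.one_apply] at this
    linarith
  have hP : ∀ a b, ∑ c, A a c * A b c = if a = b then 2 * k + 1 else k := by
    intro a b
    have := congrFun (congrFun hAprod a) b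
    simp only [allOnes, Matrix.one_apply, Matrix.mul_apply, Matrix.add_apply, Matrix.smul_apply,
      Matrix.sub_apply, Matrix.transpose_apply, Matrix.of_apply, smul_eq_mul] at this
    rw [this]; split_ifs <;> ring
  have hr : ∀ a, ∑ c, A a c = 2 * k + 1 := by
    intro a
    rw [← (hP a a).trans (if_pos rfl)]
    refine Finset.sum_congr rfl fun c _ => ?_
    rcases hA01 a c with h | h <;> simp [h]
  have hc : ∀ a, ∑ c, A c a = 2 * k + 1 := by
    intro a
    simp_rw [hs a]
    simp [Finset.sum_sub_distrib, hr, h3]; ring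
  have hd : ∀ a, A a a = 0 := by
    intro a; have := hs a a; simp at this; omega
  have hQ : ∀ a b, ∑ c, A a c * A c b = if a = b then 0 else k + 1 - A a b := by
    intro a b
    have : ∀ c, A a c * A c b = A a c - (if b = c then A a c else 0) - A a c * A b c := by
      intro c; rw [hs b c]; split_ifs <;> ring
    simp_rw [this]
    simp [Finset.sum_sub_distrib, hr, hP]
    split_ifs with h
    · subst h; simp [hd]
    · ring
  refine ⟨k, h3, h1, hr, hc, hP, ?_, hQ⟩
  intro a b
  have : ∀ c, A c a * A c b = A c b - (if a = c then A c b else 0) - A a c * A c b := by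
    intro c; rw [hs a c]; split_ifs <;> ring
  simp_rw [this]
  simp [Finset.sum_sub_distrib, hc, hQ]
  split_ifs with h
  · subst h; simp [hd]
  · ring

/-- antipode on one side -/
def anti {n : ℕ} : BVert n → BVert n
  | Sum.inl _ => Sum.inr (Sum.inr (Sum.inr ()))
  | Sum.inr (Sum.inl a) => Sum.inr (Sum.inr (Sum.inl a))
  | Sum.inr (Sum.inr (Sum.inl a)) => Sum.inr (Sum.inl a)
  | Sum.inr (Sum.inr (Sum.inr _)) => Sum.inl ()

/-- antipode -/
def ant {n : ℕ} : BVert n ⊕ BVert n → BVert n ⊕ BVert n := Sum.map anti anti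

lemma anti_anti {n : ℕ} (x : BVert n) : anti (anti x) = x := by
  rcases x with _ | _ | _ | _ <;> rfl

lemma ant_ant {n : ℕ} (x : BVert n ⊕ BVert n) : ant (ant x) = x := by
  rcases x with x | x <;> simp [ant, anti_anti]

lemma ant_side {n : ℕ} (x : BVert n ⊕ BVert n) : (ant x).isLeft = x.isLeft := by
  rcases x with x | x <;> simp [ant]

lemma facts (n : ℕ) (hn3 : n % 4 = 3)
    (A : Matrix (Fin n) (Fin n) ℤ)
    (hA01 : ∀ i j, A i j = 0 ∨ A i j = 1)
    (hAsum : A + Aᵀ = allOnes n - 1)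
    (hAprod : A * Aᵀ = (((n - 1) / 2 : ℕ) : ℤ) • (1 : Matrix (Fin n) (Fin n) ℤ) +
      (((n - 3) / 4 : ℕ) : ℤ) • (allOnes n - 1)) :
    (∀ x, ∑ z, Bmat A x z = n) ∧
    (∀ x y, x.isLeft = y.isLeft → x ≠ y → y ≠ ant x →
      ∑ z, Bmat A x z * Bmat A y z = ((n - 1) / 2 : ℕ)) ∧
    (∀ x, ∑ z, Bmat A x z * Bmat A (ant x) z = 0) ∧
    (∀ x y, x.isLeft ≠ y.isLeft → ∑ z, Bmat A x z * Bmat A y z = 0) := by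
  obtain ⟨k, h3, h1, hr, hc, hP, hP', hQ⟩ := sums n hn3 A hA01 hAsum hAprod
  have hs : ∀ a b, A a b + A b a = 1 - (if a = b then 1 else 0) := by
    intro a b
    have := congrFun (congrFun hAsum a) b
    simp [allOnes, Matrix.one_apply] at this
    linarith
  have hQ' : ∀ a b, ∑ c, A c a * A b c = if a = b then 0 else k + 1 - A b a := by
    intro a b
    rw [← (Finset.sum_congr rfl fun c _ => mul_comm (A b c) (A c a)), hQ]
    simp [eq_comm]
  rw [h1]
  refine ⟨?_, ?_, ?_, ?_⟩
  · rintro ((_ | _ | _ | _) | (_ | _ | _ | _)) <;>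
      simp [Bmat, C1mat, hr, hc] <;> linarith
  · rintro ((_ | a | a | _) | (_ | a | a | _)) ((_ | b | b | _) | (_ | b | b | _)) hxy hne hna <;>
      simp [Bmat, C1mat, hr, hc, hP, hP', hQ, hQ', ant, anti] at hxy hne hna ⊢ <;>
      (have := hs a b; grind)
  · rintro ((_ | a | a | _) | (_ | a | a | _)) <;>
      simp [Bmat, C1mat, hr, hc, hP, hP', hQ, hQ', ant, anti]
  · rintro (x | x) (y | y) h <;> simp [Bmat] at h ⊢

lemma B01 {n : ℕ} (A : Matrix (Fin n) (Fin n) ℤ)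
    (hA01 : ∀ i j, A i j = 0 ∨ A i j = 1) (i j) : Bmat A i j = 0 ∨ Bmat A i j = 1 := by
  rcases i with ((_ | a | a | _) | (_ | a | a | _)) <;>
    rcases j with ((_ | b | b | _) | (_ | b | b | _)) <;> simp [Bmat, C1mat, hA01]

lemma Bsymm {n : ℕ} (A : Matrix (Fin n) (Fin n) ℤ) : (Bmat A).IsSymm := by
  unfold Bmat
  exact Matrix.IsSymm.fromBlocks (by simp [Matrix.IsSymm]) rfl (by simp [Matrix.IsSymm])

lemma B_side {n : ℕ} (A : Matrix (Fin n) (Fin n) ℤ) (x y) (h : Bmat A x y = 1) :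
    y.isLeft = !x.isLeft := by
  rcases x with x | x <;> rcases y with y | y <;> simp [Bmat] at h ⊢

/-- Purely graph-theoretic part. -/
lemma graph_part {V : Type*} [Fintype V] [Nonempty V] (G : SimpleGraph V) (n m : ℕ)
    (hn : 2 ≤ n) (hm : 1 ≤ m) (side : V → Bool) (ant : V → V)
    (hant : ∀ x, ant (ant x) = x) (hantne : ∀ x, ant x ≠ x)
    (hantside : ∀ x, side (ant x) = side x)
    (hside : ∀ x y, G.Adj x y → side y = !side x)
    (h1 : ∀ x, (G.neighborSet x).ncard = n)
    (h2 : ∀ x y, side x = side y → x ≠ y → y ≠ ant x → (G.commonNeighbors x y).ncard = m)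
    (h3 : ∀ x, (G.commonNeighbors x (ant x)).ncard = 0)
    (h4 : ∀ x y, side x ≠ side y → (G.commonNeighbors x y).ncard = 0) :
    G.Connected ∧ IsBipartiteGraph G ∧ G.diam = 4 ∧
      IsAmplyRegular G (Fintype.card V) n 0 m := by
  classical
  have hcn : ∀ x z, G.Adj x z → ¬ G.Adj (ant x) z := by
    intro x z hz hz'
    have := h3 x
    rw [Set.ncard_eq_zero (Set.toFinite _)] at this
    have hmem : z ∈ G.commonNeighbors x (ant x) := ⟨hz, hz'⟩
    simp [this] at hmem
  have w2 : ∀ x y, side x = side y → x ≠ y → y ≠ ant x → ∃ p : G.Walk x y, p.length = 2 := by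
    intro x y hs hne hna
    have := h2 x y hs hne hna
    obtain ⟨z, hz, hz'⟩ := Set.nonempty_of_ncard_ne_zero (by omega : (G.commonNeighbors x y).ncard ≠ 0)
    have hz : G.Adj x z := hz
    have hz' : G.Adj y z := hz'
    exact ⟨.cons hz (.cons hz'.symm .nil), rfl⟩
  have nb : ∀ x y, ∃ z, G.Adj x z ∧ z ≠ y := by
    intro x y
    obtain ⟨z, hz, hne⟩ := Set.exists_ne_of_one_lt_ncard (by rw [h1 x]; omega : 1 < (G.neighborSet x).ncard) y
    exact ⟨z, hz, hne⟩
  have w3 : ∀ x y, side x ≠ side y → ∃ p : G.Walk x y, p.length ≤ 3 := by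
    intro x y hs
    obtain ⟨z, hz, hne⟩ := nb x (ant y)
    have hsz := hside _ _ hz
    by_cases hzy : z = y
    · subst hzy; exact ⟨.cons hz .nil, by simp⟩
    · obtain ⟨p, hp⟩ := w2 z y (by rw [hsz]; revert hs; cases side x <;> cases side y <;> simp) hzy
        (fun h => hne (by rw [h, hant]))
      exact ⟨.cons hz p, by simp [hp]⟩
  have w4 : ∀ x y, ∃ p : G.Walk x y, p.length ≤ 4 := by
    intro x y
    by_cases hs : side x = side y
    · obtain ⟨z, hz, -⟩ := nb x x
      obtain ⟨p, hp⟩ := w3 z y (by rw [hside _ _ hz, hs]; simp)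
      exact ⟨.cons hz p, by simp; omega⟩
    · obtain ⟨p, hp⟩ := w3 x y hs
      exact ⟨p, by omega⟩
  have hconn : G.Connected := ⟨fun x y => ⟨(w4 x y).choose⟩⟩
  have hle : G.ediam ≤ 4 := by
    refine SimpleGraph.ediam_le_of_edist_le fun u v => ?_
    obtain ⟨p, hp⟩ := w4 u v
    exact (SimpleGraph.edist_le p).trans (by exact_mod_cast hp)
  have hnt : G.ediam ≠ ⊤ := fun h => by simp [h] at hle
  have hd : G.diam = 4 := by
    apply le_antisymm
    · exact ENat.toNat_le_of_le_coe hle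
    · obtain ⟨x⟩ := ‹Nonempty V›
      refine le_trans ?_ (SimpleGraph.dist_le_diam hnt (u := x) (v := ant x))
      obtain ⟨p, hp⟩ := hconn.exists_walk_length_eq_dist x (ant x)
      rw [← hp]
      by_contra! hlt
      have hs := hantside x
      generalize hy : ant x = y at *
      match p with
      | .nil => exact hantne _ hy
      | .cons a .nil => have := hside _ _ a; simp_all
      | .cons a (.cons b .nil) => exact hcn _ _ a (by rw [hy]; exact b.symm)
      | .cons a (.cons b (.cons c .nil)) =>
        have ha := hside _ _ a
        have hb := hside _ _ b
        have hc := hside _ _ c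
        simp_all
      | .cons a (.cons b (.cons c (.cons d q))) => simp at hlt; omega
  refine ⟨hconn, ⟨{x | side x = true}, ?_⟩, hd, rfl, h1, ?_, ?_⟩
  · intro x y h
    simp [hside _ _ h]
  · intro x y h
    exact h4 _ _ (by simp [hside _ _ h])
  · intro x y h
    obtain ⟨p, hp⟩ := hconn.exists_walk_length_eq_dist x y
    rw [h] at hp
    match p with
    | .nil => simp at hp
    | .cons a .nil => simp at hp
    | .cons a (.cons b .nil) =>
      refine h2 _ _ (by simp [hside _ _ b, hside _ _ a]) ?_ ?_
      · rintro rfl; simp at h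
      · rintro rfl; exact hcn _ _ a b.symm
    | .cons a (.cons b (.cons c q)) => simp at hp

end Aux15

/-- Let `n ≥ 5` with `n ≡ 3 (mod 4)`, and let `A` be an `n × n` integer matrix with
entries in `{0,1}`, zero diagonal, `A + Aᵀ = J - I` and
`A·Aᵀ = ((n-1)/2)·I + ((n-3)/4)·(J - I)`.  Then `B = [[0, C₁], [C₁ᵀ, 0]]` is symmetric
with entries in `{0,1}` and zero diagonal, and the simple graph `Γ` on `4n + 4` vertices
with adjacency matrix `B` is a connected bipartite amply regular graph with diameter `4`
and parameters `(4n+4, n, 0, (n-1)/2)`. -/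
theorem stmt15 (n : ℕ) (hn5 : 5 ≤ n) (hn3 : n % 4 = 3)
    (A : Matrix (Fin n) (Fin n) ℤ)
    (hA01 : ∀ i j, A i j = 0 ∨ A i j = 1)
    (hAdiag : ∀ i, A i i = 0)
    (hAsum : A + Aᵀ = allOnes n - 1)
    (hAprod : A * Aᵀ = (((n - 1) / 2 : ℕ) : ℤ) • (1 : Matrix (Fin n) (Fin n) ℤ) +
      (((n - 3) / 4 : ℕ) : ℤ) • (allOnes n - 1)) :
    (Bmat A).IsSymm ∧
    (∀ i j, Bmat A i j = 0 ∨ Bmat A i j = 1) ∧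
    (∀ i, Bmat A i i = 0) ∧
    ∀ Γ : SimpleGraph (BVert n ⊕ BVert n),
      (∀ a b, Γ.Adj a b ↔ Bmat A a b = 1) →
      Fintype.card (BVert n ⊕ BVert n) = 4 * n + 4 ∧
      Γ.Connected ∧ IsBipartiteGraph Γ ∧ Γ.diam = 4 ∧
      IsAmplyRegular Γ (4 * n + 4) n 0 ((n - 1) / 2) := by
  classical
  obtain ⟨F1, F2, F3, F4⟩ := Aux15.facts n hn3 A hA01 hAsum hAprod
  have h01 := Aux15.B01 A hA01
  refine ⟨Aux15.Bsymm A, h01, ?_, ?_⟩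
  · rintro ((_ | a | a | _) | (_ | a | a | _)) <;> simp [Bmat]
  intro Γ hΓ
  have hcard : Fintype.card (BVert n ⊕ BVert n) = 4 * n + 4 := by
    simp; ring
  refine ⟨hcard, ?_⟩
  rw [← hcard]
  have hN : ∀ x, ((Γ.neighborSet x).ncard : ℤ) = ∑ z, Bmat A x z := by
    intro x
    have : Γ.neighborSet x = ((Finset.univ.filter fun z => Bmat A x z = 1 : Finset _) : Set _) := by
      ext z; simp [hΓ]
    rw [this, Set.ncard_coe_finset, Finset.card_filter]
    push_cast
    refine Finset.sum_congr rfl fun z _ => ?_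
    rcases h01 x z with h | h <;> simp [h]
  have hC : ∀ x y, ((Γ.commonNeighbors x y).ncard : ℤ) = ∑ z, Bmat A x z * Bmat A y z := by
    intro x y
    have : Γ.commonNeighbors x y =
        ((Finset.univ.filter fun z => Bmat A x z = 1 ∧ Bmat A y z = 1 : Finset _) : Set _) := by
      ext z; simp [hΓ, SimpleGraph.mem_commonNeighbors]
    rw [this, Set.ncard_coe_finset, Finset.card_filter]
    push_cast
    refine Finset.sum_congr rfl fun z _ => ?_
    rcases h01 x z with h | h <;> rcases h01 y z with h' | h' <;> simp [h, h']
  refine Aux15.graph_part Γ n ((n - 1) / 2) (by omega) (by omega) Sum.isLeft Aux15.ant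
    Aux15.ant_ant ?_ Aux15.ant_side (fun x y h => Aux15.B_side A x y ((hΓ x y).1 h)) ?_ ?_ ?_ ?_
  · rintro ((_ | a | a | _) | (_ | a | a | _)) <;> simp [Aux15.ant, Aux15.anti]
  · intro x; exact_mod_cast (hN x).trans (F1 x)
  · intro x y h h' h''; exact_mod_cast (hC x y).trans (F2 x y h h' h'')
  · intro x; exact_mod_cast (hC x _).trans (F3 x)
  · intro x y h; exact_mod_cast (hC x y).trans (F4 x y h)
end
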